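/- There is a universal constant C ≥ 1 with the following property. Let X be a geodesic metric space homeomorphic to D̄. Then for every r > 0 there exist a finite metric simplicial complex Σ and C-Lipschitz maps ψ : X → Σ and φ : Σ → E(X) such that: (i) Σ has dimension at most 2 and carries a geodesic metric in which every simplex is a Euclidean simplex of side length r; and (ii) the image of φ is contained in the Cr-neighborhood of X in E(X), and d(x, φ(ψ(x))) ≤ Cr for all x ∈ X. -/

import Mathlib

noncomputable section

/-- The Euclidean plane `ℝ²`. -/
abbrev E2 : Type := EuclideanSpace ℝ (Fin 2)

/-- The open unit disc `D ⊆ ℝ²`. -/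
def unitDisc : Set E2 := Metric.ball 0 1

/-- The closed unit disc `D̄ ⊆ ℝ²`. -/
def unitClosedDisc : Set E2 := Metric.closedBall 0 1

/-- The unit circle `S¹ ⊆ ℝ²`. -/
def unitCircle : Set E2 := Metric.sphere 0 1

/-- A curve in a metric space: a function which is continuous on a compact interval `[a,b]`. -/
structure MCurve (X : Type*) [PseudoEMetricSpace X] where
  a : ℝ
  b : ℝ
  hab : a ≤ b
  toFun : ℝ → X
  cont : ContinuousOn toFun (Set.Icc a b)

/-- The length of a curve, i.e. its total variation. -/
def MCurve.length {X : Type*} [PseudoEMetricSpace X] (γ : MCurve X) : ENNReal :=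
  eVariationOn γ.toFun (Set.Icc γ.a γ.b)

/-- A metric space is geodesic if any two points are joined by a curve whose length equals
their distance. -/
def IsGeodesicSpace (X : Type*) [MetricSpace X] : Prop :=
  ∀ x y : X, ∃ γ : MCurve X, γ.toFun γ.a = x ∧ γ.toFun γ.b = y ∧ γ.length = edist x y

/-- A metric space is locally geodesic if every point has a neighborhood `U` such that any two
points of `U` are joined by a geodesic in `X`. -/
def IsLocallyGeodesicSpace (X : Type*) [MetricSpace X] : Prop :=
  ∀ x : X, ∃ U ∈ nhds x, ∀ y ∈ U, ∀ z ∈ U,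
    ∃ γ : MCurve X, γ.toFun γ.a = y ∧ γ.toFun γ.b = z ∧ γ.length = edist y z

/-- The vertices of the standard equilateral Euclidean simplex of side length `r`. -/
def simplexVertex (r : ℝ) (i : Fin 3) : EuclideanSpace ℝ (Fin 3) :=
  (r / Real.sqrt 2) • EuclideanSpace.single i (1:ℝ)

/-- The standard equilateral Euclidean `k`-simplex of side length `r` (for `k ≤ 2`). -/
def euclideanSimplex (r : ℝ) (k : Fin 3) : Set (EuclideanSpace ℝ (Fin 3)) :=
  convexHull ℝ (simplexVertex r '' {i : Fin 3 | i ≤ k})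

/-- A finite metric simplicial complex of dimension at most `2`, equipped with a geodesic
metric in which every simplex is a Euclidean simplex of side length `r`. -/
structure EuclideanComplex2 (r : ℝ) where
  space : Type
  [metricSpace : MetricSpace space]
  [measurableSpace : MeasurableSpace space]
  [borelSpace : BorelSpace space]
  ι : Type
  [finite : Finite ι]
  dim : ι → Fin 3
  face : ι → Set space
  face_isom : ∀ i, Nonempty (↥(face i) ≃ᵢ ↥(euclideanSimplex r (dim i)))
  covers : ⋃ i, face i = Set.univ
  geodesic : IsGeodesicSpace space

attribute [instance] EuclideanComplex2.metricSpace EuclideanComplex2.measurableSpace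
  EuclideanComplex2.borelSpace EuclideanComplex2.finite

/-- The `1`-skeleton of such a complex. -/
def EuclideanComplex2.oneSkeleton {r : ℝ} (K : EuclideanComplex2 r) : Set K.space :=
  ⋃ i ∈ {i | K.dim i ≤ 1}, K.face i

open Metric MeasureTheory Set Filter Topology ENNReal NNReal



/-- The metric speed `|f'|(t)` of a map `f : ℝ → X`. -/
def metricSpeed {X : Type*} [PseudoEMetricSpace X] (f : ℝ → X) (t : ℝ) : ℝ≥0∞ :=
  Filter.limsup (fun s : ℝ => edist (f s) (f t) / ENNReal.ofReal |s - t|) (𝓝[≠] t)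

/-- The path integral `∫_γ ρ` of a Borel density `ρ` along a curve `γ`. -/
def MCurve.pathIntegral {X : Type*} [PseudoEMetricSpace X] (γ : MCurve X) (ρ : X → ℝ≥0∞) : ℝ≥0∞ :=
  ∫⁻ t in Set.Icc γ.a γ.b, ρ (γ.toFun t) * metricSpeed γ.toFun t

/-- The family of curves whose image is contained in `S`. -/
def CurvesIn {X : Type*} [PseudoEMetricSpace X] (S : Set X) : Set (MCurve X) :=
  {γ | ∀ t ∈ Set.Icc γ.a γ.b, γ.toFun t ∈ S}

/-- The family `u ∘ Γ` of all compositions `u ∘ γ`, `γ ∈ Γ`. -/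
def mapFamily {X Y : Type*} [PseudoEMetricSpace X] [PseudoEMetricSpace Y]
    (u : X → Y) (Γ : Set (MCurve X)) : Set (MCurve Y) :=
  {δ | ∃ γ ∈ Γ, δ.a = γ.a ∧ δ.b = γ.b ∧ δ.toFun = u ∘ γ.toFun}

section Modulus

variable {X : Type*} [EMetricSpace X] [MeasurableSpace X] [BorelSpace X]

/-- A Borel function `ρ` is admissible for the curve family `Γ` if `∫_γ ρ ≥ 1` for every
(locally) rectifiable curve in `Γ`. -/
def Admissible (Γ : Set (MCurve X)) (ρ : X → ℝ≥0∞) : Prop :=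
  Measurable ρ ∧ ∀ γ ∈ Γ, γ.length ≠ ⊤ → 1 ≤ γ.pathIntegral ρ

/-- The conformal modulus of a family of curves, with respect to Hausdorff `2`-measure. -/
def MOD (Γ : Set (MCurve X)) : ℝ≥0∞ :=
  ⨅ (ρ : X → ℝ≥0∞) (_ : Admissible Γ ρ), ∫⁻ x, ρ x ^ 2 ∂(μH[2] : Measure X)

/-- The family of curves joining `E` and `F` within `G`. -/
def joiningCurves (E F G : Set X) : Set (MCurve X) :=
  {γ | (∀ t ∈ Set.Icc γ.a γ.b, γ.toFun t ∈ G) ∧ γ.toFun γ.a ∈ E ∧ γ.toFun γ.b ∈ F}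

/-- `MOD(E, F; G)`, the modulus of the family of curves joining `E` and `F` within `G`. -/
def MODJoin (E F G : Set X) : ℝ≥0∞ := MOD (joiningCurves E F G)

end Modulus


/-- A Jordan curve: a subset homeomorphic to the unit circle. -/
def IsJordanCurve {X : Type*} [TopologicalSpace X] (Γ : Set X) : Prop :=
  Nonempty (↥Γ ≃ₜ ↥unitCircle)

/-- A Jordan domain: a domain whose boundary is a Jordan curve. -/
def IsJordanDomain {X : Type*} [TopologicalSpace X] (Ω : Set X) : Prop :=
  IsOpen Ω ∧ IsConnected Ω ∧ IsJordanCurve (frontier Ω)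

/-- A subset has finite length if it is the image of a rectifiable curve. -/
def HasFiniteLength {X : Type*} [MetricSpace X] (Γ : Set X) : Prop :=
  ∃ γ : MCurve X, γ.toFun '' Set.Icc γ.a γ.b = Γ ∧ γ.length ≠ ⊤

/-- `u` restricted to `S` is a homeomorphism onto `T`. -/
def RestrictsToHomeo {A X : Type*} [TopologicalSpace A] [TopologicalSpace X]
    (u : A → X) (S : Set A) (T : Set X) : Prop :=
  ∃ e : ↥S ≃ₜ ↥T, ∀ z : ↥S, (e z : X) = u (z : A)

/-- Condition (⋆): points have vanishing modulus. -/
def PointsZeroModulus (X : Type*) [MetricSpace X] [MeasurableSpace X] [BorelSpace X] : Prop :=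
  ∀ (x : X) (R : ℝ), 0 < R → ((Metric.ball x R)ᶜ).Nonempty →
    Filter.Tendsto
      (fun r : ℝ => MODJoin (Metric.ball x r) (Metric.ball x R)ᶜ (Metric.closedBall x R))
      (𝓝[>] (0:ℝ)) (𝓝 0)

/-- Condition (⋆⋆): for every closed topological square `Q ⊆ X` with boundary edges
`ζ₁, ζ₂, ζ₃, ζ₄` in cyclic order, `MOD(ζ₁,ζ₃;Q) ⬝ MOD(ζ₂,ζ₄;Q) ≤ κ`. -/
def SquareCondition (X : Type*) [MetricSpace X] [MeasurableSpace X] [BorelSpace X]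
    (κ : ℝ≥0∞) : Prop :=
  ∀ (φ : ℝ × ℝ → X) (Q : Set X),
    RestrictsToHomeo φ (Set.Icc (0:ℝ) 1 ×ˢ Set.Icc (0:ℝ) 1) Q →
    MODJoin (φ '' (Set.Icc (0:ℝ) 1 ×ˢ {(0:ℝ)})) (φ '' (Set.Icc (0:ℝ) 1 ×ˢ {(1:ℝ)})) Q *
      MODJoin (φ '' ({(0:ℝ)} ×ˢ Set.Icc (0:ℝ) 1)) (φ '' ({(1:ℝ)} ×ˢ Set.Icc (0:ℝ) 1)) Q ≤ κ

section Sobolev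

variable {X : Type*} [MetricSpace X]

/-- `g` is a weak upper gradient of `u` on `U`: the upper gradient inequality holds along all
rectifiable curves in `U` outside an exceptional family of modulus zero. -/
def IsWeakUpperGradientOn (u : E2 → X) (U : Set E2) (g : E2 → ℝ≥0∞) : Prop :=
  ∃ Γ₀ : Set (MCurve E2), MOD Γ₀ = 0 ∧
    ∀ γ : MCurve E2, γ ∈ CurvesIn U → γ.length ≠ ⊤ → γ ∉ Γ₀ →
      edist (u (γ.toFun γ.a)) (u (γ.toFun γ.b)) ≤ γ.pathIntegral g

/-- Membership in the Newton–Sobolev space `N^{1,2}(U, X)`. -/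
def MemN12 (U : Set E2) (u : E2 → X) : Prop :=
  AEStronglyMeasurable u (volume.restrict U) ∧
  (∃ x₀ : X, (∫⁻ z in U, edist (u z) x₀ ^ 2) ≠ ⊤) ∧
  ∃ g : E2 → ℝ≥0∞, Measurable g ∧ IsWeakUpperGradientOn u U g ∧ (∫⁻ z in U, g z ^ 2) ≠ ⊤

/-- The Reshetnyak energy `E²₊(u)` of `u` on the unit disc: the infimum of `∫_D g²` over all
weak upper gradients `g` of `u` (attained by the minimal weak upper gradient). -/
def energy (u : E2 → X) : ℝ≥0∞ :=
  ⨅ (g : E2 → ℝ≥0∞) (_ : Measurable g ∧ IsWeakUpperGradientOn u unitDisc g),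
    ∫⁻ z in unitDisc, g z ^ 2

/-- `g` is the minimal weak upper gradient of `u` on the unit disc. -/
def IsMinimalWUG (u : E2 → X) (g : E2 → ℝ≥0∞) : Prop :=
  Measurable g ∧ IsWeakUpperGradientOn u unitDisc g ∧ (∫⁻ z in unitDisc, g z ^ 2) ≠ ⊤ ∧
    ∀ h : E2 → ℝ≥0∞, Measurable h → IsWeakUpperGradientOn u unitDisc h →
      (∫⁻ z in unitDisc, h z ^ 2) ≠ ⊤ → ∀ᵐ z ∂(volume.restrict unitDisc), g z ≤ h z

/-- `c` is a representative of the trace of `u`: for a.e. `v ∈ S¹` the radial limit of `u`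
at `v` is `c v`. -/
def IsTraceRep (u c : E2 → X) : Prop :=
  ∀ᵐ v ∂((μH[1] : Measure E2).restrict unitCircle),
    Filter.Tendsto (fun t : ℝ => u (t • v)) (𝓝[<] (1:ℝ)) (𝓝 (c v))

/-- `c` (restricted to `S¹`) is a weakly monotone parametrization of the Jordan curve `Γ`:
a uniform limit of homeomorphisms `S¹ → Γ`. -/
def IsWeaklyMonotoneParam {Y : Type*} [MetricSpace Y] (c : E2 → Y) (Γ : Set Y) : Prop :=
  ContinuousOn c unitCircle ∧ (∀ v ∈ unitCircle, c v ∈ Γ) ∧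
    ∀ ε : ℝ, 0 < ε → ∃ h : ↥unitCircle ≃ₜ ↥Γ,
      ∀ v : ↥unitCircle, dist (c (v : E2)) ((h v : ↥Γ) : Y) < ε

/-- The family `Λ(Γ, X)` of Sobolev discs spanning the Jordan curve `Γ`. -/
def Lambda (Γ : Set X) : Set (E2 → X) :=
  {u | MemN12 unitDisc u ∧ ∃ c : E2 → X, IsWeaklyMonotoneParam c Γ ∧ IsTraceRep u c}

/-- The seminorm `s` is the approximate metric derivative of `u` at `z`:
`ap lim_{y → z} (d(u y, u z) - s(y-z)) / |y-z| = 0`. -/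
def HasApproxMetricDeriv (u : E2 → X) (z : E2) (s : Seminorm ℝ E2) : Prop :=
  ∀ ε : ℝ, 0 < ε →
    Filter.Tendsto
      (fun r : ℝ =>
        volume {y : E2 | y ∈ Metric.ball z r ∧
            ε * ‖y - z‖ ≤ |dist (u y) (u z) - s (y - z)|} / volume (Metric.ball z r))
      (𝓝[>] (0:ℝ)) (𝓝 0)

end Sobolev

open Classical in
/-- The Jacobian `J(s)` of a seminorm `s` on `ℝ²`: the Hausdorff 2-measure of the unit square
in `(ℝ², s)` when `s` is a norm (which equals `π / |{s ≤ 1}|`), and `0` otherwise. -/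
def seminormJacobian (s : Seminorm ℝ E2) : ℝ≥0∞ :=
  if ∃ v : E2, v ≠ 0 ∧ s v = 0 then 0
  else ENNReal.ofReal Real.pi / volume {v : E2 | s v ≤ 1}

/-- `u` is infinitesimally `K`-quasiconformal: `g_u(z)² ≤ K ⬝ J(md u_z)` for a.e. `z ∈ D`. -/
def InfinitesimallyQC {X : Type*} [MetricSpace X] (u : E2 → X) (K : ℝ≥0∞) : Prop :=
  ∃ g : E2 → ℝ≥0∞, IsMinimalWUG u g ∧
    ∀ᵐ z ∂(volume.restrict unitDisc),
      ∃ s : Seminorm ℝ E2, HasApproxMetricDeriv u z s ∧ g z ^ 2 ≤ K * seminormJacobian s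

/-- The parametrized (Hausdorff) area `Area(u) = ∫_D J(md u_z) dz`. -/
def parametrizedArea {X : Type*} [MetricSpace X] (u : E2 → X) : ℝ≥0∞ :=
  ∫⁻ z in unitDisc, ⨆ (s : Seminorm ℝ E2) (_ : HasApproxMetricDeriv u z s), seminormJacobian s

/-- The essential oscillation of `u` in the `δ`-ball around `z` (within the unit disc). -/
def essOsc {X : Type*} [MetricSpace X] (u : E2 → X) (z : E2) (δ : ℝ) : ℝ≥0∞ :=
  ⨅ (A : Set E2)
    (_ : A ⊆ unitDisc ∩ Metric.ball z δ ∧ volume ((unitDisc ∩ Metric.ball z δ) \ A) = 0),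
    EMetric.diam (u '' A)

/-- A quasisymmetric map between metric spaces. -/
def IsQuasisymmetric {M X : Type*} [MetricSpace M] [MetricSpace X] (u : M → X) : Prop :=
  ∃ η : ℝ≥0 ≃ₜ ℝ≥0, ∀ z a b : M, ∀ t : ℝ≥0,
    dist z a ≤ (t : ℝ) * dist z b → dist (u z) (u a) ≤ (η t : ℝ) * dist (u z) (u b)

/-- A map `u` is quasisymmetric on a subset `S` of its domain. -/
def IsQuasisymmetricOn {M X : Type*} [MetricSpace M] [MetricSpace X] (u : M → X)
    (S : Set M) : Prop :=
  ∃ η : ℝ≥0 ≃ₜ ℝ≥0, ∀ z ∈ S, ∀ a ∈ S, ∀ b ∈ S, ∀ t : ℝ≥0,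
    dist z a ≤ (t : ℝ) * dist z b → dist (u z) (u a) ≤ (η t : ℝ) * dist (u z) (u b)

/-- A metric space is linearly locally connected. -/
def LinearlyLocallyConnected (X : Type*) [MetricSpace X] : Prop :=
  ∃ lam : ℝ, 1 ≤ lam ∧ ∀ (x : X) (r : ℝ), 0 < r →
    (∀ y ∈ Metric.ball x r, ∀ z ∈ Metric.ball x r, ∃ C : Set X, IsCompact C ∧ IsConnected C ∧
      y ∈ C ∧ z ∈ C ∧ C ⊆ Metric.ball x (lam * r)) ∧
    (∀ y ∉ Metric.ball x r, ∀ z ∉ Metric.ball x r, ∃ C : Set X, IsCompact C ∧ IsConnected C ∧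
      y ∈ C ∧ z ∈ C ∧ C ⊆ (Metric.ball x (r / lam))ᶜ)

/-- A subset `S` is `2`-rectifiable: up to an `H²`-null set, `S` is covered by countably many
Lipschitz images of subsets of `ℝ²`. -/
def Is2Rectifiable {X : Type*} [MetricSpace X] [MeasurableSpace X] [BorelSpace X]
    (S : Set X) : Prop :=
  ∃ (A : ℕ → Set E2) (f : ℕ → E2 → X), (∀ n, ∃ K : ℝ≥0, LipschitzOnWith K (f n) (A n)) ∧
    μH[2] (S \ ⋃ n, f n '' A n) = 0

/-- The boundary circle `∂X` of a space homeomorphic to the closed disc. -/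
def discBoundary {X : Type*} [TopologicalSpace X] (φ : ↥unitClosedDisc ≃ₜ X) : Set X :=
  {x : X | ((φ.symm x : ↥unitClosedDisc) : E2) ∈ unitCircle}

/-- `f` is biLipschitz on `S`. -/
def BiLipschitzOn {A X : Type*} [PseudoMetricSpace A] [PseudoMetricSpace X]
    (f : A → X) (S : Set A) : Prop :=
  ∃ K : ℝ≥0, 0 < K ∧ ∀ v ∈ S, ∀ w ∈ S,
    (K : ℝ)⁻¹ * dist v w ≤ dist (f v) (f w) ∧ dist (f v) (f w) ≤ (K : ℝ) * dist v w

/-- A biLipschitz curve: the image of a biLipschitz embedding of `S¹` or of an interval. -/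
def IsBiLipschitzCurve {X : Type*} [MetricSpace X] (T : Set X) : Prop :=
  (∃ f : E2 → X, BiLipschitzOn f unitCircle ∧ f '' unitCircle = T) ∨
  (∃ f : ℝ → X, BiLipschitzOn f (Set.Icc 0 1) ∧ f '' Set.Icc 0 1 = T)

/-- `T` is a Jordan arc intersecting the set `B` exactly at its two endpoints. -/
def IsJordanArcMeetingBoundaryAtEndpoints {X : Type*} [TopologicalSpace X] (T B : Set X) : Prop :=
  ∃ h : ↥(Set.Icc (0:ℝ) 1) ≃ₜ ↥T,
    T ∩ B = {((h ⟨0, Set.mem_Icc.mpr (by norm_num)⟩ : ↥T) : X),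
             ((h ⟨1, Set.mem_Icc.mpr (by norm_num)⟩ : ↥T) : X)}

/-- `c` is a continuous-representative-of-trace of `u` on the convex domain `W`, with respect to
radial approach from an interior point `p`. -/
def IsTraceRepOn {X : Type*} [MetricSpace X] (u c : E2 → X) (W : Set E2) (p : E2) : Prop :=
  ∀ᵐ w ∂((μH[1] : Measure E2).restrict (frontier W)),
    Filter.Tendsto (fun t : ℝ => u ((1 - t) • p + t • w)) (𝓝[<] (1:ℝ)) (𝓝 (c w))

/-- The induced length (inner) distance of a metric space. -/
def lengthDist {X : Type*} [MetricSpace X] (x y : X) : ℝ≥0∞ :=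
  ⨅ (γ : MCurve X) (_ : γ.toFun γ.a = x ∧ γ.toFun γ.b = y), γ.length

/-- An injective metric space: `1`-Lipschitz maps into it extend from subsets. -/
def IsInjectiveMetricSpace (E : Type*) [MetricSpace E] : Prop :=
  ∀ (Z : Type) [MetricSpace Z], ∀ (Y : Set Z) (f : ↥Y → E), LipschitzWith 1 f →
    ∃ F : Z → E, LipschitzWith 1 F ∧ ∀ y : ↥Y, F (y : Z) = f y



/-- The total variation `ℓ 1 - ℓ 0` of a continuous logarithm `ℓ` of `f`. -/
def logVariation (f : ℝ → ℂ) : ℂ :=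
  open Classical in
  if h : ∃ l : ℝ → ℂ, Continuous l ∧ ∀ t, Complex.exp (l t) = f t then
    h.choose 1 - h.choose 0 else 0

theorem exists_continuous_log {Y : Type*} [TopologicalSpace Y] [LocallyPathConnectedSpace Y]
    [SimplyConnectedSpace Y] {f : Y → ℂ} (hf : Continuous f) (h0 : ∀ t, f t ≠ 0) :
    ∃ l : Y → ℂ, Continuous l ∧ ∀ t, Complex.exp (l t) = f t := by
  obtain ⟨a⟩ : Nonempty Y := inferInstance
  obtain ⟨F, ⟨-, hF⟩, -⟩ := Complex.isCoveringMapOn_exp.existsUnique_continuousMap_lifts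
    ⟨f, hf⟩ (a₀ := a) (Complex.exp_log (h0 a)) (fun x => h0 x)
  exact ⟨F, F.continuous, fun t => congrFun hF t⟩

theorem logVariation_eq {f l : ℝ → ℂ} {c : ℂ} (hc : c ≠ 0) (hl : Continuous l)
    (h : ∀ t, Complex.exp (l t) = c * f t) : logVariation f = l 1 - l 0 := by
  have hex : ∃ l : ℝ → ℂ, Continuous l ∧ ∀ t, Complex.exp (l t) = f t :=
    ⟨fun t => l t - Complex.log c, by fun_prop, fun t => by
      rw [Complex.exp_sub, h, Complex.exp_log hc]; field_simp⟩
  rw [logVariation, dif_pos hex]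
  obtain ⟨hm, he⟩ := hex.choose_spec
  have key : l 1 - hex.choose 1 = l 0 - hex.choose 0 := by
    refine Complex.isCoveringMap_exp.const_of_comp (g := fun t => l t - hex.choose t)
      (by fun_prop) (fun a a' => ?_) 1 0
    have hne : ∀ t, f t ≠ 0 := fun t => by rw [← he]; exact Complex.exp_ne_zero _
    ext
    simp only [Complex.exp_sub, h, he]
    rw [mul_div_cancel_right₀ _ (hne a), mul_div_cancel_right₀ _ (hne a')]
  linear_combination -key

theorem exp_logVariation {f : ℝ → ℂ} (hf : Continuous f) (h0 : ∀ t, f t ≠ 0) :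
    Complex.exp (logVariation f) = f 1 / f 0 := by
  obtain ⟨l, hl, h⟩ := exists_continuous_log hf h0
  rw [logVariation_eq one_ne_zero hl (f := f) (by simpa using h), Complex.exp_sub, h, h]

/-- The variations of the logarithm of `α s - β t` along the sides of the unit square add up
to zero. -/
theorem logVariation_square {α β : ℝ → ℂ} (hα : Continuous α) (hβ : Continuous β)
    (h : ∀ s t, α s ≠ β t) :
    logVariation (fun t => β t - α 1) - logVariation (fun t => β t - α 0) =
      logVariation (fun s => α s - β 1) - logVariation (fun s => α s - β 0) := by
  obtain ⟨L, hL, hexp⟩ := exists_continuous_log (Y := ℝ × ℝ) (f := fun p => α p.1 - β p.2)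
    (by fun_prop) (fun p => sub_ne_zero.2 (h _ _))
  rw [logVariation_eq (c := -1) (l := fun t => L (1, t)) (by simp) (by fun_prop)
      (fun t => by rw [hexp]; ring),
    logVariation_eq (c := -1) (l := fun t => L (0, t)) (by simp) (by fun_prop)
      (fun t => by rw [hexp]; ring),
    logVariation_eq (c := 1) (l := fun t => L (t, 1)) (by simp) (by fun_prop)
      (fun t => by rw [hexp]; ring),
    logVariation_eq (c := 1) (l := fun t => L (t, 0)) (by simp) (by fun_prop)
      (fun t => by rw [hexp]; ring)]
  ring

/-- `K₃₃` cannot be drawn in the plane: any drawing has two crossing non-adjacent edges. -/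
theorem exists_crossing_K33 {A B : Fin 3 → ℂ} {γ : Fin 3 → Fin 3 → ℝ → ℂ}
    (hγ : ∀ x i, Continuous (γ x i)) (h0 : ∀ x i, γ x i 0 = A x) (h1 : ∀ x i, γ x i 1 = B i) :
    ∃ x y i j s t, x ≠ y ∧ i ≠ j ∧ γ x i s = γ y j t := by
  by_contra! hne
  let q : Fin 3 → Fin 3 → Fin 3 → ℂ := fun x y j => logVariation (fun t => γ y j t - A x)
  let p : Fin 3 → Fin 3 → Fin 3 → ℂ := fun i y j => logVariation (fun t => γ y j t - B i)
  have rel : ∀ x y i j, x ≠ y → i ≠ j → p i y j - q x y j = p j x i - q y x i := by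
    intro x y i j hxy hij
    have := logVariation_square (hγ x i) (hγ y j) (fun s t => hne x y i j s t hxy hij)
    simpa only [h0, h1] using this
  have hAA : ∀ x y, x ≠ y → A x ≠ A y := fun x y hxy => by
    simpa [h0] using hne x y 0 1 0 0 hxy (by decide)
  have hAB : ∀ x i, B i ≠ A x := fun x i => by
    obtain ⟨y, hy⟩ := exists_ne x
    obtain ⟨j, hj⟩ := exists_ne i
    simpa [h0, h1] using hne y x i j 1 0 hy hj.symm
  have hq : ∀ x y j, x ≠ y → Complex.exp (q x y j) = (B j - A x) / (A y - A x) := by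
    intro x y j hxy
    obtain ⟨i, hi⟩ := exists_ne j
    have := exp_logVariation (f := fun t => γ y j t - A x) ((hγ y j).sub continuous_const)
      (fun t => sub_ne_zero.2 (by simpa [h0] using (hne x y i j 0 t hxy hi).symm))
    simpa only [h0, h1] using this
  let T : Fin 3 → ℂ := fun j => q 1 0 j - q 2 0 j + (q 2 1 j - q 0 1 j) + (q 0 2 j - q 1 2 j)
  have hT : ∀ i j, i ≠ j → T i = - T j := by
    intro i j hij
    have e1 := rel 1 0 i j (by decide) hij
    have e2 := rel 2 0 i j (by decide) hij
    have e3 := rel 2 1 i j (by decide) hij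
    have e4 := rel 0 1 i j (by decide) hij
    have e5 := rel 0 2 i j (by decide) hij
    have e6 := rel 1 2 i j (by decide) hij
    simp only [T]
    linear_combination -e1 + e2 - e3 + e4 - e5 + e6
  have hT0 : T 0 = 0 := by
    have e1 := hT 0 1 (by decide)
    have e2 := hT 1 2 (by decide)
    have e3 := hT 0 2 (by decide)
    linear_combination (e1 - e2 + e3) / 2
  have hexp : Complex.exp (T 0) = -1 := by
    simp only [T, Complex.exp_add, Complex.exp_sub]
    rw [hq, hq, hq, hq, hq, hq] <;> try decide
    have := sub_ne_zero.2 (hAA 0 1 (by decide))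
    have := sub_ne_zero.2 (hAA 1 0 (by decide))
    have := sub_ne_zero.2 (hAA 0 2 (by decide))
    have := sub_ne_zero.2 (hAA 2 0 (by decide))
    have := sub_ne_zero.2 (hAA 1 2 (by decide))
    have := sub_ne_zero.2 (hAA 2 1 (by decide))
    have := sub_ne_zero.2 (hAB 0 0)
    have := sub_ne_zero.2 (hAB 1 0)
    have := sub_ne_zero.2 (hAB 2 0)
    field_simp
    ring
  rw [hT0, Complex.exp_zero] at hexp
  norm_num at hexp

/-- A space which injects continuously into the plane does not contain a `K₃₃` whose
non-adjacent edges are disjoint. -/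
theorem not_K33_of_injective {X : Type*} [TopologicalSpace X] {h : X → ℂ} (hc : Continuous h)
    (hi : Function.Injective h) {A B : Fin 3 → X} {F : Fin 3 → Fin 3 → Set X}
    (hF : ∀ x i, JoinedIn (F x i) (A x) (B i)) :
    ¬ ∀ x y i j, x ≠ y → i ≠ j → Disjoint (F x i) (F y j) := by
  intro hd
  choose g hg using hF
  obtain ⟨x, y, i, j, s, t, hxy, hij, hst⟩ := exists_crossing_K33 (A := h ∘ A) (B := h ∘ B)
    (γ := fun x i t => h ((g x i).extend t)) (fun x i => hc.comp (g x i).continuous_extend)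
    (by simp) (by simp)
  have mem : ∀ x i t, (g x i).extend t ∈ F x i := fun x i t => hg x i _
  exact Set.disjoint_left.1 (hd x y i j hxy hij) (mem x i s) (hi hst ▸ mem y j t)

/-- `x` and `y` are joined by a curve of length at most `L` inside `S`. -/
def ConnIn {Y : Type*} [PseudoMetricSpace Y] (S : Set Y) (L : ℝ) (x y : Y) : Prop :=
  0 ≤ L ∧ ∃ g : ℝ → Y, LipschitzWith 1 g ∧ (∀ t, g t ∈ S) ∧ g 0 = x ∧ g L = y

namespace ConnIn

variable {Y : Type*} [PseudoMetricSpace Y] {S T : Set Y} {L L' : ℝ} {x y z : Y}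

theorem refl (hx : x ∈ S) : ConnIn S 0 x x :=
  ⟨le_rfl, fun _ => x, LipschitzWith.const' x, fun _ => hx, rfl, rfl⟩

theorem left_mem (h : ConnIn S L x y) : x ∈ S := by
  obtain ⟨-, g, -, h2, rfl, -⟩ := h; exact h2 _

theorem right_mem (h : ConnIn S L x y) : y ∈ S := by
  obtain ⟨-, g, -, h2, -, rfl⟩ := h; exact h2 _

theorem dist_le (h : ConnIn S L x y) : dist x y ≤ L := by
  obtain ⟨h0, g, h1, -, rfl, rfl⟩ := h
  simpa [Real.dist_eq, abs_of_nonneg h0] using h1.dist_le_mul 0 L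

theorem subpath {g : ℝ → Y} (hg : LipschitzWith 1 g) (hS : ∀ t, g t ∈ S) {s t : ℝ} (hst : s ≤ t) :
    ConnIn S (t - s) (g s) (g t) :=
  ⟨sub_nonneg.2 hst, fun u => g (s + u),
    LipschitzWith.of_dist_le_mul fun a b => by simpa using hg.dist_le_mul (s + a) (s + b),
    fun _ => hS _, by simp, by simp⟩

/-- A curve defined on an interval can be extended by constants. -/
theorem of_lipschitzOn {g : ℝ → Y} {a b : ℝ} (hab : a ≤ b) (hg : LipschitzOnWith 1 g (Icc a b))
    (hS : ∀ t ∈ Icc a b, g t ∈ S) : ConnIn S (b - a) (g a) (g b) := by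
  let G : ℝ → Y := fun t => g (projIcc a b hab t)
  have hG : LipschitzWith 1 G := by
    have := hg.to_restrict.comp (LipschitzWith.projIcc hab)
    rwa [mul_one] at this
  have := subpath (S := S) hG (fun t => hS _ (projIcc a b hab t).2) hab
  simpa [G] using this

theorem mono (h : ConnIn S L x y) (hL : L ≤ L') (hST : S ⊆ T) : ConnIn T L' x y := by
  obtain ⟨h0, g, h1, h2, rfl, rfl⟩ := h
  refine ⟨h0.trans hL, fun t => g (min t L), ?_, fun t => hST (h2 _), by simp [h0], by simp [hL]⟩
  refine LipschitzWith.of_dist_le_mul fun a b => (h1.dist_le_mul _ _).trans ?_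
  gcongr
  rw [Real.dist_eq, Real.dist_eq]
  simpa using abs_min_sub_min_le_max a L b L

theorem mono_length (h : ConnIn S L x y) (hL : L ≤ L') : ConnIn S L' x y := h.mono hL subset_rfl

theorem symm (h : ConnIn S L x y) : ConnIn S L y x := by
  obtain ⟨h0, g, h1, h2, rfl, rfl⟩ := h
  refine ⟨h0, fun t => g (L - t), ?_, fun _ => h2 _, by simp, by simp⟩
  refine LipschitzWith.of_dist_le_mul fun a b => (h1.dist_le_mul _ _).trans ?_
  rw [dist_sub_left]

theorem trans (h : ConnIn S L x y) (h' : ConnIn S L' y z) : ConnIn S (L + L') x z := by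
  obtain ⟨h0, g, h1, h2, rfl, rfl⟩ := h
  obtain ⟨h0', g', h1', h2', hy, rfl⟩ := h'
  have hle : ∀ a b : ℝ, a ≤ L → L ≤ b → dist (g a) (g' (b - L)) ≤ b - a := by
    intro a b ha hb
    have e1 := h1.dist_le_mul a L
    have e2 := h1'.dist_le_mul 0 (b - L)
    rw [hy] at e2
    rw [Real.dist_eq, abs_of_nonpos (by linarith)] at e1 e2
    have := dist_triangle (g a) (g L) (g' (b - L))
    norm_num at e1 e2
    linarith
  refine ⟨by linarith, fun t => if t ≤ L then g t else g' (t - L), ?_, fun t => ?_, by simp [h0], ?_⟩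
  · refine LipschitzWith.of_dist_le_mul fun a b => ?_
    rw [NNReal.coe_one, one_mul]
    split_ifs with ha hb hb
    · simpa using h1.dist_le_mul a b
    · rw [dist_comm a b, Real.dist_eq]
      exact (hle a b ha (not_le.1 hb).le).trans (le_abs_self _)
    · rw [dist_comm (g' _), Real.dist_eq]
      exact (hle b a hb (not_le.1 ha).le).trans (le_abs_self _)
    · simpa using h1'.dist_le_mul (a - L) (b - L)
  · dsimp only
    split_ifs
    exacts [h2 _, h2' _]
  · dsimp only
    split_ifs with h
    · have : L' = 0 := by linarith
      subst this
      simp [hy]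
    · simp

theorem joinedIn (h : ConnIn S L x y) : JoinedIn S x y := by
  obtain ⟨h0, g, h1, h2, rfl, rfl⟩ := h
  refine JoinedIn.ofLine (f := fun t => g (t * L)) ?_ (by simp) (by simp) ?_
  · exact (h1.continuous.comp (by fun_prop)).continuousOn
  · rintro _ ⟨t, -, rfl⟩
    exact h2 _

end ConnIn

/-- In a geodesic space any two points are joined by a geodesic parametrized by arc length. -/
theorem IsGeodesicSpace.exists_arclength {X : Type*} [MetricSpace X] (hX : IsGeodesicSpace X)
    (x y : X) : ∃ g : ℝ → X, g 0 = x ∧ g (dist x y) = y ∧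
      ∀ s ∈ Icc 0 (dist x y), ∀ t ∈ Icc 0 (dist x y), dist (g s) (g t) = |s - t| := by
  obtain ⟨⟨a, b, hab, f, hf⟩, rfl, rfl, hlen⟩ := hX x y
  simp only [MCurve.length] at *
  have key : ∀ s ∈ Icc a b, ∀ t ∈ Icc a b, s ≤ t →
      dist (f s) (f t) = dist (f a) (f t) - dist (f a) (f s) := by
    intro s hs t ht hst
    have e1 : edist (f a) (f s) + edist (f s) (f t) + edist (f t) (f b) ≤ edist (f a) (f b) := by
      have e2 := eVariationOn.Icc_add_Icc f (s := univ) hs.1 hs.2 (mem_univ s)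
      have e3 := eVariationOn.Icc_add_Icc f (s := univ) hst ht.2 (mem_univ t)
      simp only [univ_inter] at e2 e3
      rw [← hlen, ← e2, ← e3, add_assoc]
      gcongr
      exacts [eVariationOn.edist_le f ⟨le_rfl, hs.1⟩ ⟨hs.1, le_rfl⟩,
        eVariationOn.edist_le f ⟨le_rfl, hst⟩ ⟨hst, le_rfl⟩,
        eVariationOn.edist_le f ⟨le_rfl, ht.2⟩ ⟨ht.2, le_rfl⟩]
    rw [edist_dist, edist_dist, edist_dist, edist_dist, ← ENNReal.ofReal_add (by positivity) (by positivity),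
      ← ENNReal.ofReal_add (by positivity) (by positivity),
      ENNReal.ofReal_le_ofReal_iff (by positivity)] at e1
    have := dist_triangle (f a) (f s) (f t)
    have := dist_triangle (f a) (f t) (f b)
    linarith
  have hsurj : ∀ u ∈ Icc 0 (dist (f a) (f b)), ∃ t ∈ Icc a b, dist (f a) (f t) = u := by
    have := intermediate_value_Icc hab (f := fun t => dist (f a) (f t)) (by fun_prop)
    simp only [dist_self] at this
    exact this
  choose! τ hτ hτd using hsurj
  have h0 : (0 : ℝ) ∈ Icc 0 (dist (f a) (f b)) := ⟨le_rfl, dist_nonneg⟩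
  have h1 : dist (f a) (f b) ∈ Icc 0 (dist (f a) (f b)) := ⟨dist_nonneg, le_rfl⟩
  refine ⟨fun u => f (τ u), ?_, ?_, ?_⟩
  · exact (dist_eq_zero.1 (hτd 0 h0)).symm
  · have := key _ (hτ _ h1) b ⟨hab, le_rfl⟩ (hτ _ h1).2
    rw [hτd _ h1, sub_self] at this
    exact dist_eq_zero.1 this
  · intro s hs t ht
    rcases le_total (τ s) (τ t) with h | h
    · have e := key _ (hτ _ hs) _ (hτ _ ht) h
      rw [hτd _ hs, hτd _ ht] at e
      rw [e, abs_sub_comm, abs_of_nonneg (e ▸ dist_nonneg)]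
    · have e := key _ (hτ _ ht) _ (hτ _ hs) h
      rw [hτd _ hs, hτd _ ht] at e
      rw [dist_comm, e, abs_of_nonneg (e ▸ dist_nonneg)]

/-- Geodesics give connections inside any set which contains the metric interval. -/
theorem IsGeodesicSpace.connIn {X : Type*} [MetricSpace X] (hX : IsGeodesicSpace X) {S : Set X}
    {x y : X} (h : ∀ z, dist x z + dist z y = dist x y → z ∈ S) : ConnIn S (dist x y) x y := by
  obtain ⟨g, h0, h1, hg⟩ := hX.exists_arclength x y
  have l : (0 : ℝ) ∈ Icc 0 (dist x y) := ⟨le_rfl, dist_nonneg⟩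
  have r : dist x y ∈ Icc 0 (dist x y) := ⟨dist_nonneg, le_rfl⟩
  have := ConnIn.of_lipschitzOn (S := S) dist_nonneg (LipschitzOnWith.of_dist_le_mul
    fun s hs t ht => (by rw [hg s hs t ht, NNReal.coe_one, one_mul, Real.dist_eq] :
      dist (g s) (g t) ≤ ((1 : ℝ≥0) : ℝ) * dist s t)) (fun t ht => h _ ?_)
  · simpa [h0, h1] using this
  · have e1 := hg 0 l t ht
    have e2 := hg t ht _ r
    rw [h0] at e1
    rw [h1] at e2
    rw [e1, e2, abs_of_nonpos (by linarith [ht.1]), abs_of_nonpos (by linarith [ht.2])]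
    ring

/-- If `q` is joined to `p` by a curve of length `k * w` but by no curve of length
`(k - 1) * w`, then this curve passes at time `(k - 5) * w` through a point which splits it
into two parts, each of which is nearly minimizing. -/
theorem ConnIn.exists_split {Y : Type*} [PseudoMetricSpace Y] {S : Set Y} {w : ℝ} (hw : 0 < w)
    {q p : Y} {k : ℕ} (hk : 5 ≤ k) (h : ConnIn S (k * w) q p) :
    ∃ m : Y, ∃ U V : Set Y, ConnIn S ((k - 5) * w) q m ∧ ConnIn S (5 * w) m p ∧
      JoinedIn U p m ∧ JoinedIn V q m ∧
      (∀ z ∈ U, ∃ τ, (k - 5) * w ≤ τ ∧ ConnIn S τ q z ∧ ConnIn S (k * w - τ) z p) ∧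
      (∀ z ∈ V, ∃ τ, τ ≤ (k - 5) * w ∧ ConnIn S τ q z ∧ ConnIn S (k * w - τ) z p) := by
  obtain ⟨h0, g, hg, hS, rfl, rfl⟩ := h
  have hk' : (5 : ℝ) ≤ k := by exact_mod_cast hk
  have h1 : 0 ≤ (k - 5) * w := mul_nonneg (by linarith) hw.le
  have h2 : (k - 5) * w ≤ k * w := by linarith
  have hsplit : ∀ τ, 0 ≤ τ → τ ≤ k * w → ConnIn S τ (g 0) (g τ) ∧
      ConnIn S (k * w - τ) (g τ) (g (k * w)) := fun τ e1 e2 =>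
    ⟨by simpa using ConnIn.subpath hg hS e1, ConnIn.subpath hg hS e2⟩
  have hj : ∀ {a b : ℝ}, a ≤ b → JoinedIn (g '' Icc a b) (g a) (g b) := fun {a b} hab =>
    ((convex_Icc a b).isPathConnected ⟨a, le_rfl, hab⟩ |>.image hg.continuous).joinedIn
      _ ⟨a, ⟨le_rfl, hab⟩, rfl⟩ _ ⟨b, ⟨hab, le_rfl⟩, rfl⟩
  refine ⟨g ((k - 5) * w), g '' Icc ((k - 5) * w) (k * w), g '' Icc 0 ((k - 5) * w),
    (hsplit _ h1 h2).1, ?_, (hj h2).symm, hj h1, ?_, ?_⟩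
  · convert (hsplit _ h1 h2).2 using 1; ring
  · rintro _ ⟨τ, ⟨e1, e2⟩, rfl⟩
    exact ⟨τ, e1, hsplit τ (h1.trans e1) e2⟩
  · rintro _ ⟨τ, ⟨e1, e2⟩, rfl⟩
    exact ⟨τ, e2, hsplit τ e1 (e2.trans h2)⟩

section Annulus

variable {X : Type*} [MetricSpace X] {e : X} {α β w : ℝ}

/-- A geodesic towards the centre leaves the annulus through its inner boundary. -/
theorem IsGeodesicSpace.exists_radial (hX : IsGeodesicSpace X) (hw : β - α ≤ w) {m : X}
    (hm : dist e m ≤ β) : ∃ P : Set X, JoinedIn P e m ∧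
      ∀ z ∈ P, z ∈ {z | α ≤ dist e z ∧ dist e z ≤ β} →
        ConnIn {z | α ≤ dist e z ∧ dist e z ≤ β} w m z := by
  refine ⟨{z | dist e z + dist z m = dist e m}, (hX.connIn fun z hz => hz).joinedIn, ?_⟩
  rintro z (hz : dist e z + dist z m = dist e m) ⟨hz1, hz2⟩
  refine (hX.connIn (x := m) (y := z) fun u hu => ?_).mono_length ?_
  · have e1 := dist_triangle e u z
    have e2 := dist_triangle e z u
    have e3 := dist_triangle e u m
    have e4 := dist_triangle m u e
    have e5 := dist_triangle e u z
    have e6 := dist_triangle e m u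
    rw [dist_comm z m] at hz
    rw [dist_comm z u] at e2
    rw [dist_comm u m] at e3
    constructor <;> linarith
  · rw [dist_comm]
    linarith

/-- Chains of points at the same level of an annulus in a planar geodesic space have bounded
length. -/
theorem IsGeodesicSpace.connIn_of_level_chain (hX : IsGeodesicSpace X) {h : X → ℂ}
    (hc : Continuous h) (hi : Function.Injective h) (hw0 : 0 < w) (hw : β - α ≤ w) {S : Set X}
    (hS : S = {z | α ≤ dist e z ∧ dist e z ≤ β}) {q : X} {k : ℕ} {lv : X → Prop}
    (hlv : ∀ x, lv x → ConnIn S (k * w) q x ∧ ¬ ConnIn S ((k - 1) * w) q x) {a b : X}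
    (ha : lv a) (hab : Relation.ReflTransGen (fun x y => lv x ∧ lv y ∧ ConnIn S w x y) a b) :
    ConnIn S (27 * w) a b := by
  by_contra hne
  have hlvb : lv b := by
    rcases Relation.ReflTransGen.cases_tail hab with rfl | ⟨c, -, -, h, -⟩
    exacts [ha, h]
  have hk : 5 ≤ k := by
    by_contra! hk
    have hk' : (k : ℝ) ≤ 4 := by exact_mod_cast Nat.lt_succ_iff.1 hk
    refine hne (((hlv a ha).1.symm.trans (hlv b hlvb).1).mono_length ?_)
    nlinarith
  -- a third point on the chain, far from both ends
  have hthird : ∀ y, Relation.ReflTransGen (fun x y => lv x ∧ lv y ∧ ConnIn S w x y) a y →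
      ConnIn S (13 * w) a y ∨ ∃ c, lv c ∧
        Relation.ReflTransGen (fun x y => lv x ∧ lv y ∧ ConnIn S w x y) a c ∧
        Relation.ReflTransGen (fun x y => lv x ∧ lv y ∧ ConnIn S w x y) c y ∧
        ¬ ConnIn S (13 * w) a c ∧ ConnIn S (14 * w) a c := by
    intro y hy
    induction hy with
    | refl => exact .inl ((ConnIn.refl (hlv a ha).1.right_mem).mono_length (by positivity))
    | @tail y z hy hyz ih =>
      rcases ih with ih | ⟨c, hc0, hc1, hc2, hc3⟩
      · by_cases hz : ConnIn S (13 * w) a z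
        · exact .inl hz
        · exact .inr ⟨z, hyz.2.1, hy.tail hyz, .refl, hz,
            (ih.trans hyz.2.2).mono_length (by linarith)⟩
      · exact .inr ⟨c, hc0, hc1, hc2.tail hyz, hc3⟩
  obtain hab' | ⟨c, hlvc, hac, hcb, hnac, hac'⟩ := hthird b hab
  · exact hne (hab'.mono_length (by linarith))
  have hnab : ¬ ConnIn S (13 * w) a b := fun h => hne (h.mono_length (by linarith))
  have hncb : ¬ ConnIn S (13 * w) c b := fun h => hne ((hac'.trans h).mono_length (by linarith))
  -- the first hub
  let H : Set X := {z | ∃ y, lv y ∧ ConnIn S w z y}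
  have hH : ∀ x y, lv x → Relation.ReflTransGen (fun x y => lv x ∧ lv y ∧ ConnIn S w x y) x y →
      JoinedIn H x y := by
    intro x y hx hxy
    induction hxy with
    | refl =>
      exact JoinedIn.refl ⟨x, hx, (ConnIn.refl (hlv x hx).1.right_mem).mono_length hw0.le⟩
    | tail _ hyz ih =>
      refine ih.trans ?_
      obtain ⟨-, hz, -, g, hg, hgS, rfl, rfl⟩ := hyz
      have : IsPathConnected (g '' Icc 0 w) :=
        ((convex_Icc 0 w).isPathConnected ⟨0, le_rfl, hw0.le⟩).image hg.continuous
      refine (this.joinedIn _ ⟨0, ⟨le_rfl, hw0.le⟩, rfl⟩ _ ⟨w, ⟨hw0.le, le_rfl⟩, rfl⟩).mono ?_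
      rintro _ ⟨τ, hτ, rfl⟩
      exact ⟨_, hz, (ConnIn.subpath hg hgS hτ.2).mono_length (by linarith [hτ.1])⟩
  have hHlv : ∀ z ∈ H, ∀ L, ConnIn S L q z → (k - 2) * w < L := by
    rintro z ⟨y, hy, hzy⟩ L hL
    by_contra! hlt
    exact (hlv y hy).2 ((hL.trans hzy).mono_length (by linarith))
  let p : Fin 3 → X := ![a, c, b]
  have hp : ∀ i, lv (p i) := by
    intro i
    fin_cases i
    exacts [ha, hlvc, hlvb]
  have hpne : ∀ i j, i ≠ j → ¬ ConnIn S (13 * w) (p i) (p j) := by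
    have hca := fun h => hnac (ConnIn.symm h)
    have hba := fun h => hnab (ConnIn.symm h)
    have hbc := fun h => hncb (ConnIn.symm h)
    intro i j hij
    fin_cases i <;> fin_cases j <;> first | exact absurd rfl hij | assumption
  have hcp : ∀ i, JoinedIn H c (p i) := by
    intro i
    fin_cases i
    exacts [(hH _ _ ha hac).symm, hH _ _ hlvc .refl, hH _ _ hlvc hcb]
  choose m U V hm1 hm2 hU hV hU' hV' using fun i => (hlv _ (hp i)).1.exists_split hw0 hk
  have hP : ∀ i, ∃ P : Set X, JoinedIn P e (m i) ∧ ∀ z ∈ P, z ∈ S → ConnIn S w (m i) z := by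
    intro i
    have := (hm1 i).right_mem
    subst hS
    exact hX.exists_radial hw this.2
  choose P hP1 hP2 using hP
  let F : Fin 3 → Fin 3 → Set X := ![fun i => H ∪ U i, V, P]
  have hF : ∀ x i, JoinedIn (F x i) (![c, q, e] x) (m i) := by
    intro x i
    fin_cases x
    · exact ((hcp i).mono subset_union_left).trans ((hU i).mono subset_union_right)
    · exact hV i
    · exact hP1 i
  have d01 : ∀ i j, i ≠ j → Disjoint (H ∪ U i) (V j) := by
    intro i j hij
    rw [Set.disjoint_left]
    intro z hz hzV
    obtain ⟨τ', h1', h2', h3'⟩ := hV' j z hzV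
    rcases hz with hz | hz
    · have := hHlv z hz _ h2'
      linarith
    · obtain ⟨τ, h1, h2, h3⟩ := hU' i z hz
      refine hpne i j hij ((h3.symm.trans h3').mono_length ?_)
      have : (k - 1) * w < τ' + (k * w - τ) := by
        by_contra! hlt
        exact (hlv _ (hp i)).2 ((h2'.trans h3).mono_length hlt)
      linarith
  have d02 : ∀ i j, i ≠ j → Disjoint (H ∪ U i) (P j) := by
    intro i j hij
    rw [Set.disjoint_left]
    intro z hz hzP
    rcases hz with hz | hz
    · have hzS : z ∈ S := by
        obtain ⟨y, -, h⟩ := hz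
        exact h.left_mem
      have := hHlv z hz _ ((hm1 j).trans (hP2 j z hzP hzS))
      linarith
    · obtain ⟨τ, h1, h2, h3⟩ := hU' i z hz
      refine hpne i j hij ((h3.symm.trans
        ((hP2 j z hzP h2.right_mem).symm.trans (hm2 j))).mono_length ?_)
      linarith
  have d12 : ∀ i j, i ≠ j → Disjoint (V i) (P j) := by
    intro i j hij
    rw [Set.disjoint_left]
    intro z hz hzP
    obtain ⟨τ, h1, h2, h3⟩ := hV' i z hz
    have hzm := (hP2 j z hzP h2.right_mem).symm.trans (hm2 j)
    refine hpne i j hij ((h3.symm.trans hzm).mono_length ?_)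
    have : (k - 1) * w < τ + (w + 5 * w) := by
      by_contra! hlt
      exact (hlv _ (hp j)).2 ((h2.trans hzm).mono_length hlt)
    linarith
  refine not_K33_of_injective hc hi hF fun x y i j hxy hij => ?_
  fin_cases x <;> fin_cases y <;> first
    | exact absurd rfl hxy
    | exact d01 i j hij
    | exact d02 i j hij
    | exact d12 i j hij
    | exact (d01 j i hij.symm).symm
    | exact (d02 j i hij.symm).symm
    | exact (d12 j i hij.symm).symm

/-- An annulus in a planar geodesic space can be coloured by two colours such that
monochromatic chains with small steps are bounded. -/
theorem IsGeodesicSpace.exists_coloring_annulus (hX : IsGeodesicSpace X) {h : X → ℂ}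
    (hc : Continuous h) (hi : Function.Injective h) (e : X) {α β s w : ℝ} (hs : 0 < s)
    (hsw : s ≤ w) (hw : β - α + 2 * s ≤ w) :
    ∃ c : X → Bool, ∀ x y, Relation.ReflTransGen (fun x y =>
        (α ≤ dist e x ∧ dist e x ≤ β) ∧ (α ≤ dist e y ∧ dist e y ≤ β) ∧
          c x = c y ∧ dist x y ≤ s) x y → dist x y ≤ 27 * w := by
  have hw0 : 0 < w := hs.trans_le hsw
  let S : Set X := {z | α - s ≤ dist e z ∧ dist e z ≤ β + s}
  let R : S → S → Prop := fun x y => ∃ n : ℕ, ConnIn S (n * w) (x : X) y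
  let st : Setoid S := ⟨R, fun x => ⟨0, by simpa using ConnIn.refl x.2⟩,
    fun ⟨n, hn⟩ => ⟨n, hn.symm⟩,
    fun ⟨n, hn⟩ ⟨m, hm⟩ => ⟨n + m, (hn.trans hm).mono_length (by push_cast; linarith)⟩⟩
  let q : S → S := fun x => (Quotient.mk st x).out
  have hq : ∀ x : S, ∃ n : ℕ, ConnIn S (n * w) (q x : X) x := fun x => Quotient.mk_out (s := st) x
  classical
  let n : S → ℕ := fun x => Nat.find (hq x)
  have hn : ∀ x : S, ConnIn S (n x * w) (q x : X) x := fun x => Nat.find_spec (hq x)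
  have hn' : ∀ (x : S) (L : ℕ), ConnIn S (L * w) (q x : X) x → n x ≤ L :=
    fun x L hL => Nat.find_min' (hq x) hL
  have hstep : ∀ x y : S, ConnIn S w (x : X) y → q x = q y ∧ n y ≤ n x + 1 := by
    intro x y hxy
    have hqq : q x = q y :=
      congrArg Quotient.out (Quotient.sound (s := st) ⟨1, by simpa using hxy⟩)
    refine ⟨hqq, hn' y _ ?_⟩
    rw [← hqq]
    exact ((hn x).trans hxy).mono_length (by push_cast; linarith)
  let N : Set X := {z | α ≤ dist e z ∧ dist e z ≤ β}
  have hNS : N ⊆ S := fun z hz => ⟨by linarith [hz.1], by linarith [hz.2]⟩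
  let c : X → Bool := fun x => if hx : x ∈ S then decide (Even (n ⟨x, hx⟩)) else false
  refine ⟨c, fun x y hxy => ?_⟩
  rcases Relation.ReflTransGen.cases_head hxy with rfl | ⟨x', hx', -⟩
  · simpa using hw0.le
  have hxS : x ∈ S := hNS hx'.1
  let lv : X → Prop := fun z => ∃ hz : z ∈ S, q ⟨z, hz⟩ = q ⟨x, hxS⟩ ∧ n ⟨z, hz⟩ = n ⟨x, hxS⟩
  have hlv : ∀ z, lv z → ConnIn S (n ⟨x, hxS⟩ * w) (q ⟨x, hxS⟩ : X) z ∧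
      ¬ ConnIn S ((n ⟨x, hxS⟩ - 1) * w) (q ⟨x, hxS⟩ : X) z := by
    rintro z ⟨hz, h1, h2⟩
    rw [← h1, ← h2]
    refine ⟨hn ⟨z, hz⟩, fun hlt => ?_⟩
    have h0 : 1 ≤ n ⟨z, hz⟩ := by
      by_contra! h0
      have e0 : n ⟨z, hz⟩ = 0 := by omega
      have := hlt.1
      rw [e0] at this
      push_cast at this
      linarith
    have := hn' ⟨z, hz⟩ (n ⟨z, hz⟩ - 1) (by push_cast [h0]; exact hlt)
    omega
  have hchain : lv y ∧
      Relation.ReflTransGen (fun x y => lv x ∧ lv y ∧ ConnIn S w x y) x y := by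
    clear hx'
    induction hxy with
    | refl => exact ⟨⟨hxS, rfl, rfl⟩, .refl⟩
    | @tail y z _ hyz ih =>
      obtain ⟨⟨hyS, hy1, hy2⟩, ihc⟩ := ih
      obtain ⟨hyN, hzN, hcc, hd⟩ := hyz
      have hzS : z ∈ S := hNS hzN
      have hconn : ConnIn S w y z := by
        refine (hX.connIn (S := S) fun u hu => ?_).mono_length (hd.trans hsw)
        have := dist_triangle e u y
        have := dist_triangle e y u
        rw [dist_comm u y] at *
        have := dist_nonneg (x := u) (y := z)
        constructor <;> linarith [hyN.1, hyN.2]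
      have h1 := hstep ⟨y, hyS⟩ ⟨z, hzS⟩ hconn
      have h2 := hstep ⟨z, hzS⟩ ⟨y, hyS⟩ hconn.symm
      simp only [c, hyS, hzS, dif_pos, decide_eq_decide] at hcc
      have hnn : n ⟨z, hzS⟩ = n ⟨y, hyS⟩ := by
        have h1 := h1.2
        have h2 := h2.2
        rcases Nat.even_or_odd (n ⟨y, hyS⟩) with ho | ho
        · obtain ⟨a, ha⟩ := ho
          obtain ⟨b, hb⟩ := hcc.1 ⟨a, ha⟩
          omega
        · have hz : ¬ Even (n ⟨z, hzS⟩) := fun hz => Nat.not_even_iff_odd.2 ho (hcc.2 hz)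
          obtain ⟨a, ha⟩ := ho
          obtain ⟨b, hb⟩ := Nat.not_even_iff_odd.1 hz
          omega
      have hlz : lv z := ⟨hzS, h1.1.symm.trans hy1, hnn.trans hy2⟩
      exact ⟨hlz, ihc.tail ⟨⟨hyS, hy1, hy2⟩, hlz, hconn⟩⟩
  exact (hX.connIn_of_level_chain hc hi hw0 (by linarith) (S := S) rfl hlv ⟨hxS, rfl, rfl⟩
    hchain.2).dist_le

end Annulus

/-- If the parts of a set inside and outside of `B` have bounded chains, where the steps allowed
outside of `B` are larger than the bound inside of `B`, then the whole set has bounded chains. -/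
theorem dist_le_of_chain_union {X : Type*} [PseudoMetricSpace X] {G B : X → Prop}
    {PB PA : X → X → Prop} {r D₀ D₁ : ℝ} (hr : 0 ≤ r) (hD₀ : 0 ≤ D₀) (hD₁ : 0 ≤ D₁)
    (hB : ∀ x y, G x → G y → B x → B y → dist x y ≤ r → PB x y)
    (hA : ∀ x y, G x → G y → ¬ B x → ¬ B y → dist x y ≤ D₀ + 2 * r → PA x y)
    (hPB : ∀ x y, Relation.ReflTransGen PB x y → dist x y ≤ D₀)
    (hPA : ∀ x y, Relation.ReflTransGen PA x y → dist x y ≤ D₁) {x y : X} (hx : G x)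
    (hxy : Relation.ReflTransGen (fun x y => G x ∧ G y ∧ dist x y ≤ r) x y) :
    dist x y ≤ D₁ + 2 * (D₀ + r) := by
  have key : G y ∧ ((B y ∧ Relation.ReflTransGen PB x y) ∨
      ∃ a a', dist x a ≤ D₀ + r ∧ Relation.ReflTransGen PA a a' ∧ G a' ∧ ¬ B a' ∧
        (y = a' ∨ B y ∧ ∃ b, dist a' b ≤ r ∧ Relation.ReflTransGen PB b y)) := by
    induction hxy with
    | refl =>
      refine ⟨hx, ?_⟩
      by_cases h : B x
      · exact .inl ⟨h, .refl⟩
      · exact .inr ⟨x, x, by simpa using by positivity, .refl, hx, h, .inl rfl⟩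
    | @tail y z _ hyz ih =>
      obtain ⟨hy, ih⟩ := ih
      obtain ⟨-, hz, hd⟩ := hyz
      refine ⟨hz, ?_⟩
      by_cases hBz : B z
      · rcases ih with ⟨hBy, ih⟩ | ⟨a, a', h1, h2, h3, h4, rfl | ⟨hBy, b, h5, h6⟩⟩
        · exact .inl ⟨hBz, ih.tail (hB y z hy hz hBy hBz hd)⟩
        · exact .inr ⟨a, y, h1, h2, h3, h4, .inr ⟨hBz, z, hd, .refl⟩⟩
        · exact .inr ⟨a, a', h1, h2, h3, h4, .inr
            ⟨hBz, b, h5, h6.tail (hB y z hy hz hBy hBz hd)⟩⟩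
      · refine .inr ?_
        rcases ih with ⟨hBy, ih⟩ | ⟨a, a', h1, h2, h3, h4, rfl | ⟨hBy, b, h5, h6⟩⟩
        · exact ⟨z, z, (dist_triangle _ y _).trans (add_le_add (hPB _ _ ih) hd), .refl, hz, hBz,
            .inl rfl⟩
        · exact ⟨a, z, h1, h2.tail (hA _ _ h3 hz h4 hBz (by linarith)), hz, hBz, .inl rfl⟩
        · refine ⟨a, z, h1, h2.tail (hA _ _ h3 hz h4 hBz ?_), hz, hBz, .inl rfl⟩
          have := hPB _ _ h6
          have := dist_triangle4 a' b y z
          linarith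
  rcases key.2 with ⟨-, h⟩ | ⟨a, a', h1, h2, -, -, rfl | ⟨-, b, h5, h6⟩⟩
  · have := hPB _ _ h
    linarith
  · have := hPA _ _ h2
    have := dist_triangle x a y
    linarith
  · have := hPA _ _ h2
    have := hPB _ _ h6
    have := dist_triangle4 x a a' y
    have := dist_triangle a' b y
    linarith

section ThreeColoring

variable {X : Type*} [MetricSpace X]

/-- Simultaneous colouring of a sequence of annuli. -/
theorem IsGeodesicSpace.exists_coloring_annuli (hX : IsGeodesicSpace X) {h : X → ℂ}
    (hc : Continuous h) (hi : Function.Injective h) (e : X) {Z : X → Prop} {κ : X → ℕ}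
    {α β : ℕ → ℝ} {s w : ℝ} (hs : 0 < s) (hsw : s ≤ w) (hw : ∀ k, β k - α k + 2 * s ≤ w)
    (hZ : ∀ x, Z x → α (κ x) ≤ dist e x ∧ dist e x ≤ β (κ x)) :
    ∃ c : X → Bool, ∀ x y, Relation.ReflTransGen (fun x y =>
        Z x ∧ Z y ∧ κ x = κ y ∧ c x = c y ∧ dist x y ≤ s) x y → dist x y ≤ 27 * w := by
  choose c hcol using fun k => hX.exists_coloring_annulus hc hi e hs hsw (hw k)
  refine ⟨fun x => c (κ x) x, fun x y hxy => hcol (κ x) x y ?_⟩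
  suffices κ x = κ y ∧ Relation.ReflTransGen _ x y from this.2
  induction hxy with
  | refl => exact ⟨rfl, .refl⟩
  | @tail y z _ hyz ih =>
    obtain ⟨hy, hz, hκ, hcc, hd⟩ := hyz
    refine ⟨ih.1.trans hκ, ih.2.tail ⟨?_, ?_, ?_, hd⟩⟩
    · rw [ih.1]; exact hZ y hy
    · rw [ih.1, hκ]; exact hZ z hz
    · rw [ih.1]
      beta_reduce at hcc
      rwa [← hκ] at hcc

/-- A planar geodesic space can be coloured by three colours such that, at scale `r`,
monochromatic chains have diameter at most a fixed multiple of `r`; that is, its Nagata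
dimension is at most two, with a universal constant. -/
theorem IsGeodesicSpace.exists_three_coloring (hX : IsGeodesicSpace X) {h : X → ℂ}
    (hc : Continuous h) (hi : Function.Injective h) {r : ℝ} (hr : 0 < r) :
    ∃ c : X → Fin 3, ∀ x y, Relation.ReflTransGen (fun x y => c x = c y ∧ dist x y ≤ r) x y →
      dist x y ≤ 9200 * r := by
  rcases isEmpty_or_nonempty X with hE | ⟨⟨e⟩⟩
  · exact ⟨fun _ => 0, fun x => (hE.false x).elim⟩
  let κ : X → ℕ := fun x => ⌊dist e x / (110 * r)⌋₊
  have hW : 0 < 110 * r := by positivity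
  have hκ1 : ∀ x, κ x * (110 * r) ≤ dist e x := fun x =>
    (le_div_iff₀ hW).1 (Nat.floor_le (by positivity))
  have hκ2 : ∀ x, dist e x < (κ x + 1) * (110 * r) := fun x =>
    (div_lt_iff₀ hW).1 (Nat.lt_floor_add_one _)
  let B : X → Prop := fun x => dist e x < κ x * (110 * r) + 2 * r
  obtain ⟨cB, hcB⟩ := hX.exists_coloring_annuli hc hi e (Z := B) (κ := κ) (s := r) (w := 4 * r)
    (α := fun k => k * (110 * r)) (β := fun k => k * (110 * r) + 2 * r) hr (by linarith)
    (fun k => by linarith) (fun x hx => ⟨hκ1 x, hx.le⟩)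
  obtain ⟨cA, hcA⟩ := hX.exists_coloring_annuli hc hi e (Z := fun x => ¬ B x) (κ := κ)
    (s := 110 * r) (w := 330 * r) (α := fun k => k * (110 * r))
    (β := fun k => (k + 1) * (110 * r)) hW (by linarith)
    (fun k => by linarith) (fun x hx => ⟨hκ1 x, (hκ2 x).le⟩)
  have hdd : ∀ x y, dist e y - dist e x ≤ dist x y := fun x y => by
    linarith [dist_triangle e x y]
  have hcast : ∀ {x y : X} {n : ℕ}, κ x + n ≤ κ y → (κ x + n : ℝ) * (110 * r) ≤ κ y * (110 * r) :=
    fun {x y n} h => by gcongr; exact_mod_cast h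
  have hBlt : ∀ x y, B x → B y → dist x y ≤ r → ¬ κ x < κ y := by
    intro x y hx hy hd hlt
    have h1 := hcast (n := 1) hlt
    have h2 := hκ1 y
    have h3 := hdd x y
    push_cast at h1
    simp only [B] at hx
    linarith
  have hBκ : ∀ x y, B x → B y → dist x y ≤ r → κ x = κ y := fun x y hx hy hd =>
    le_antisymm (not_lt.1 (hBlt y x hy hx (by rwa [dist_comm]))) (not_lt.1 (hBlt x y hx hy hd))
  have hAlt : ∀ x y, ¬ B x → ¬ B y → dist x y ≤ 110 * r →
      ((κ x % 2 = κ y % 2) ∨ dist x y ≤ r) → ¬ κ x < κ y := by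
    intro x y hx hy hd hor hlt
    have h2 := hκ2 x
    have h3 := hdd x y
    simp only [B, not_lt] at hy
    rcases hor with hpar | hd'
    · have h1 := hcast (n := 2) (x := x) (y := y) (by omega)
      push_cast at h1
      linarith
    · have h1 := hcast (n := 1) hlt
      push_cast at h1
      linarith
  have hAκ : ∀ x y, ¬ B x → ¬ B y → dist x y ≤ 110 * r →
      ((κ x % 2 = κ y % 2) ∨ dist x y ≤ r) → κ x = κ y := fun x y hx hy hd hor =>
    le_antisymm (not_lt.1 (hAlt y x hy hx (by rwa [dist_comm])
      (by rwa [dist_comm, eq_comm (a := κ y % 2)]))) (not_lt.1 (hAlt x y hx hy hd hor))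
  classical
  let c : X → Fin 3 := fun x =>
    if B x then (if cB x then 0 else 2)
    else if cA x then (if κ x % 2 = 0 then 0 else 2) else 1
  have hcBx : ∀ x, B x → (c x = 0 ∧ cB x = true ∨ c x = 2 ∧ cB x = false) := by
    intro x hx
    cases h : cB x <;> simp [c, hx, h]
  have hcAx : ∀ x, ¬ B x → (c x = 0 ∧ cA x = true ∧ κ x % 2 = 0 ∨
      c x = 2 ∧ cA x = true ∧ κ x % 2 = 1 ∨ c x = 1 ∧ cA x = false) := by
    intro x hx
    cases h : cA x
    · simp [c, hx, h]
    · rcases Nat.mod_two_eq_zero_or_one (κ x) with h' | h' <;> simp [c, hx, h, h']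
  refine ⟨c, fun x y hxy => ?_⟩
  have hchain : ∀ i, c x = i → c y = i ∧
      Relation.ReflTransGen (fun x y => c x = i ∧ c y = i ∧ dist x y ≤ r) x y := by
    rintro i hi
    induction hxy with
    | refl => exact ⟨hi, .refl⟩
    | tail _ hyz ih => exact ⟨hyz.1 ▸ ih.1, ih.2.tail ⟨ih.1, hyz.1 ▸ ih.1, hyz.2⟩⟩
  have h27 : (0 : ℝ) ≤ 27 * (330 * r) := by positivity
  by_cases h1 : c x = 1
  · refine (hcA x y ((hchain 1 h1).2.lift id fun u v huv => ?_)).trans (by linarith)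
    obtain ⟨hu, hv, hd⟩ := huv
    have hBu : ∀ u, c u = 1 → ¬ B u := fun u hu hB => by
      rcases hcBx u hB with h | h <;> simp [hu] at h
    have hcu : ∀ u, c u = 1 → cA u = false := fun u hu => by
      rcases hcAx u (hBu u hu) with h | h | h <;> simp_all
    exact ⟨hBu u hu, hBu v hv, hAκ u v (hBu u hu) (hBu v hv) (by linarith) (.inr hd),
      (hcu u hu).trans (hcu v hv).symm, hd.trans (by linarith)⟩
  · refine (dist_le_of_chain_union (G := fun z => c z = c x) (B := B) (D₀ := 27 * (4 * r)) hr.le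
      (by positivity) h27 ?_ ?_ hcB hcA rfl (hchain _ rfl).2).trans (by linarith)
    · intro u v hu hv hBu hBv hd
      refine ⟨hBu, hBv, hBκ u v hBu hBv hd, ?_, hd⟩
      have huv : c u = c v := hu.trans hv.symm
      rcases hcBx u hBu with h | h <;> rcases hcBx v hBv with h' | h' <;>
        simp [h.1, h'.1, h.2, h'.2] at huv ⊢
    · intro u v hu hv hBu hBv hd
      have hd : dist u v ≤ 110 * r := by linarith
      have huv : c u = c v := hu.trans hv.symm
      have hu1 : c u ≠ 1 := fun h => h1 (hu.symm.trans h)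
      have : κ u % 2 = κ v % 2 ∧ cA u = cA v := by
        rcases hcAx u hBu with h | h | h <;> rcases hcAx v hBv with h' | h' | h' <;>
          simp [h.1, h'.1, h.2, h'.2] at huv hu1 ⊢
      exact ⟨hBu, hBv, hAκ u v hBu hBv hd (.inl this.1), this.2, hd⟩

end ThreeColoring

section LengthMetric

variable {Y : Type*}

theorem ConnIn.map {X : Type*} [PseudoMetricSpace X] [PseudoMetricSpace Y] {f : X → Y} {K : ℝ≥0}
    (hK : K ≠ 0) (hf : LipschitzWith K f) {S : Set X} {T : Set Y} (hST : MapsTo f S T) {L : ℝ}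
    {x y : X} (h : ConnIn S L x y) : ConnIn T (K * L) (f x) (f y) := by
  obtain ⟨h0, g, h1, h2, rfl, rfl⟩ := h
  have hK' : (K : ℝ) ≠ 0 := by exact_mod_cast hK
  refine ⟨by positivity, fun t => f (g (t / K)), ?_, fun t => hST (h2 _), by simp, ?_⟩
  · refine LipschitzWith.of_dist_le_mul fun a b => (hf.dist_le_mul _ _).trans ?_
    have := h1.dist_le_mul (a / K) (b / K)
    rw [Real.dist_eq, ← _root_.sub_div, abs_div, NNReal.abs_eq] at this
    calc K * dist (g (a / K)) (g (b / K)) ≤ K * ((1 : ℝ≥0) * (|a - b| / K)) := by gcongr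
      _ = (1 : ℝ≥0) * dist a b := by rw [Real.dist_eq]; field_simp
  · simp [mul_div_cancel_left₀ _ hK']

theorem Convex.connIn [NormedAddCommGroup Y] [NormedSpace ℝ Y] {T : Set Y} (hT : Convex ℝ T)
    {x y : Y} (hx : x ∈ T) (hy : y ∈ T) : ConnIn T (dist x y) x y := by
  rcases eq_or_ne x y with rfl | hne
  · simpa using ConnIn.refl hx
  have hd : 0 < dist x y := dist_pos.2 hne
  have := ConnIn.of_lipschitzOn (S := T) (g := fun t => AffineMap.lineMap x y (t / dist x y)) hd.le
    (LipschitzWith.lipschitzOnWith (LipschitzWith.of_dist_le_mul fun a b => by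
      rw [dist_lineMap_lineMap, Real.dist_eq, ← _root_.sub_div, abs_div, abs_of_pos hd,
        div_mul_cancel₀ _ hd.ne', Real.dist_eq, NNReal.coe_one, one_mul]))
    (fun t ht => hT.lineMap_mem hx hy
      ⟨div_nonneg ht.1 hd.le, (div_le_one hd).2 ht.2⟩)
  simpa [hd.ne'] using this

/-- Shortest curves exist in compact sets. -/
theorem ConnIn.sInf_mem [MetricSpace Y] {S : Set Y} (hS : IsCompact S) {L : ℝ} {x y : Y}
    (h : ConnIn S L x y) : ConnIn S (sInf {L | ConnIn S L x y}) x y := by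
  set A := {L | ConnIn S L x y} with hA
  have hne : A.Nonempty := ⟨L, h⟩
  have h0 : 0 ≤ sInf A := le_csInf hne fun L hL => hL.1
  have hbdd : BddBelow A := ⟨0, fun L hL => hL.1⟩
  let G : Set (ℝ → Y) := {g | (∀ a b, dist (g a) (g b) ≤ dist a b) ∧ g 0 = x} ∩
    univ.pi fun _ => S
  have hGc : IsCompact G := by
    refine (isCompact_univ_pi fun _ => hS).inter_left ?_
    simp only [ofPred_and, ofPred_forall]
    refine IsClosed.inter (isClosed_iInter fun a => isClosed_iInter fun b => ?_) ?_
    · exact isClosed_le (by fun_prop) continuous_const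
    · exact isClosed_eq (by fun_prop) continuous_const
  have hmem : ∀ L ∈ A, ∃ g ∈ G, g L = y := by
    rintro L ⟨-, g, h1, h2, h3, h4⟩
    exact ⟨g, ⟨⟨fun a b => by simpa using h1.dist_le_mul a b, h3⟩, fun t _ => h2 t⟩, h4⟩
  obtain ⟨g₀, hg₀, -⟩ := hmem L h
  obtain ⟨g, hg, hmin⟩ := hGc.exists_isMinOn ⟨g₀, hg₀⟩ (f := fun g => dist (g (sInf A)) y)
    (by fun_prop)
  refine ⟨h0, g, LipschitzWith.of_dist_le_mul fun a b => by simpa using hg.1.1 a b,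
    fun t => hg.2 t trivial, hg.1.2, ?_⟩
  have : dist (g (sInf A)) y + sInf A ≤ sInf A := by
    refine le_csInf hne fun L hL => ?_
    obtain ⟨g', hg', rfl⟩ := hmem L hL
    have h1 : dist (g (sInf A)) (g' L) ≤ dist (g' (sInf A)) (g' L) := hmin hg'
    have h2 := hg'.1.1 (sInf A) L
    rw [Real.dist_eq, abs_of_nonpos (by linarith [csInf_le hbdd hL])] at h2
    linarith
  exact dist_le_zero.1 (by linarith)

/-- The points of a subset `S` of a metric space, not carrying the metric induced by the
ambient space. -/
structure PointsOf (S : Set Y) where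
  val : Y
  mem : val ∈ S

/-- The length metric on a compact set. -/
theorem exists_lengthMetric [MetricSpace Y] {S : Set Y} (hS : IsCompact S)
    (hconn : ∀ x ∈ S, ∀ y ∈ S, ∃ L, ConnIn S L x y) :
    ∃ _ : MetricSpace (PointsOf S), (∀ x y : PointsOf S, ConnIn S (dist x y) x.val y.val) ∧
      ∀ (x y : PointsOf S) (L : ℝ), ConnIn S L x.val y.val → dist x y ≤ L := by
  let d : PointsOf S → PointsOf S → ℝ := fun x y => sInf {L | ConnIn S L x.val y.val}
  have h1 : ∀ x y, ConnIn S (d x y) x.val y.val := fun x y =>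
    (hconn _ x.mem _ y.mem).elim fun L h => h.sInf_mem hS
  have h2 : ∀ x y L, ConnIn S L x.val y.val → d x y ≤ L := fun x y L h =>
    csInf_le ⟨0, fun L hL => hL.1⟩ h
  exact ⟨{
    dist := d
    dist_self := fun x => le_antisymm (h2 _ _ _ (.refl x.mem)) (h1 x x).1
    dist_comm := fun x y => le_antisymm (h2 _ _ _ (h1 y x).symm) (h2 _ _ _ (h1 x y).symm)
    dist_triangle := fun x y z => h2 _ _ _ ((h1 x y).trans (h1 y z))
    eq_of_dist_eq_zero := fun {x y} h => by
      have : dist x.val y.val ≤ 0 := h ▸ (h1 x y).dist_le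
      cases x
      cases y
      simpa using this }, h1, h2⟩

theorem isGeodesicSpace_of_connIn [MetricSpace Y] {S : Set Y} [MetricSpace (PointsOf S)]
    (h1 : ∀ x y : PointsOf S, ConnIn S (dist x y) x.val y.val)
    (h2 : ∀ (x y : PointsOf S) (L : ℝ), ConnIn S L x.val y.val → dist x y ≤ L) :
    IsGeodesicSpace (PointsOf S) := by
  intro x y
  obtain ⟨h0, g, hg, hgS, hx, hy⟩ := h1 x y
  let γ : ℝ → PointsOf S := fun t => ⟨g t, hgS t⟩
  have hγ : LipschitzWith 1 γ := by
    refine LipschitzWith.of_dist_le_mul fun a b => ?_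
    rw [NNReal.coe_one, one_mul]
    rcases le_total a b with h | h
    · rw [dist_comm a, Real.dist_eq, abs_of_nonneg (sub_nonneg.2 h)]
      exact h2 _ _ _ (.subpath hg hgS h)
    · rw [Real.dist_eq, abs_of_nonneg (sub_nonneg.2 h), dist_comm]
      exact h2 _ _ _ (.subpath hg hgS h)
  have hx' : γ 0 = x := by cases x; simp [γ, hx]
  have hy' : γ (dist x y) = y := by
    cases y; simp only [γ]; congr
  refine ⟨⟨0, dist x y, h0, γ, hγ.continuous.continuousOn⟩, hx', hy', le_antisymm ?_ ?_⟩
  · refine (LipschitzOnWith.comp_eVariationOn_le (hγ.lipschitzOnWith (s := univ))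
      (g := id) (s := Icc 0 (dist x y)) (mapsTo_univ _ _)).trans ?_
    have := (monotone_id.monotoneOn (Icc (0 : ℝ) (dist x y))).eVariationOn_eq
      (a := 0) (b := dist x y) ⟨le_rfl, h0⟩ ⟨h0, le_rfl⟩
    rw [inter_self] at this
    simp [this, edist_dist]
  · have := eVariationOn.edist_le γ (s := Icc 0 (dist x y)) ⟨le_rfl, h0⟩ ⟨h0, le_rfl⟩
    rwa [hx', hy'] at this

end LengthMetric

/-- Finitely many convex sets which are isometric to equilateral simplices, and whose union is
connected by curves of finite length, form a complex. -/
theorem exists_euclideanComplex2 {W : Type} [NormedAddCommGroup W] [NormedSpace ℝ W] {r : ℝ}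
    {ι : Type} [Finite ι] (dim : ι → Fin 3) {face : ι → Set W} (hconv : ∀ i, Convex ℝ (face i))
    (hiso : ∀ i, Nonempty (face i ≃ᵢ euclideanSimplex r (dim i)))
    (hconn : ∀ x ∈ ⋃ i, face i, ∀ y ∈ ⋃ i, face i, ∃ L, ConnIn (⋃ i, face i) L x y) :
    ∃ (K : EuclideanComplex2 r) (v : K.space → W), range v = ⋃ i, face i ∧
      (∀ x y, ConnIn (⋃ i, face i) (dist x y) (v x) (v y)) ∧
      ∀ x y L, ConnIn (⋃ i, face i) L (v x) (v y) → dist x y ≤ L := by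
  have hcpt : IsCompact (⋃ i, face i) := isCompact_iUnion fun i => by
    obtain ⟨e⟩ := hiso i
    have : CompactSpace (euclideanSimplex r (dim i)) :=
      isCompact_iff_compactSpace.1 ((toFinite _).isCompact_convexHull ℝ)
    exact isCompact_iff_compactSpace.2 e.symm.toHomeomorph.compactSpace
  obtain ⟨_, h1, h2⟩ := exists_lengthMetric hcpt hconn
  have hdist : ∀ i, ∀ x y : PointsOf (⋃ i, face i), x.val ∈ face i → y.val ∈ face i →
      dist x y = dist x.val y.val := fun i x y hx hy =>
    le_antisymm (h2 _ _ _ (((hconv i).connIn hx hy).mono le_rfl (subset_iUnion _ i)))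
      (h1 x y).dist_le
  let _ : MeasurableSpace (PointsOf (⋃ i, face i)) := borel _
  have : BorelSpace (PointsOf (⋃ i, face i)) := ⟨rfl⟩
  refine ⟨⟨PointsOf (⋃ i, face i), ι, dim, fun i => {x | x.val ∈ face i}, fun i => ?_,
    eq_univ_of_forall fun x => ?_, isGeodesicSpace_of_connIn h1 h2⟩, PointsOf.val, ?_, h1, h2⟩
  · obtain ⟨e⟩ := hiso i
    refine ⟨IsometryEquiv.trans (β := face i) (IsometryEquiv.mk' (fun x => ⟨x.1.val, x.2⟩)
      (fun x => ⟨⟨x.1, mem_iUnion_of_mem i x.2⟩, x.2⟩) (fun x => rfl) ?_) e⟩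
    exact Isometry.of_dist_eq fun x y => (hdist i _ _ x.2 y.2).symm
  · simpa using x.mem
  · exact Subset.antisymm (range_subset_iff.2 PointsOf.mem) fun x hx => ⟨⟨x, hx⟩, rfl⟩

/-- Lipschitz maps with arbitrary constants extend to maps into injective spaces. -/
theorem IsInjectiveMetricSpace.exists_extension {E : Type*} [MetricSpace E]
    (hE : IsInjectiveMetricSpace E) {Z : Type} [MetricSpace Z] {C : ℝ≥0} (hC : C ≠ 0) {Y : Set Z}
    {f : Y → E} (hf : LipschitzWith C f) :
    ∃ F : Z → E, LipschitzWith C F ∧ ∀ y : Y, F y = f y := by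
  have hC' : 0 < (C : ℝ) := by exact_mod_cast hC.bot_lt
  have hd : ∀ x y : Y, dist (f x) (f y) ≤ C * dist (x : Z) y := hf.dist_le_mul
  suffices ∃ F : Z → E, (∀ x y, dist (F x) (F y) ≤ C * dist x y) ∧ ∀ y : Y, F y = f y from
    this.imp fun F h => ⟨LipschitzWith.of_dist_le_mul h.1, h.2⟩
  let m : MetricSpace Z :=
    { dist := fun x y => C * dist x y
      dist_self := fun x => by simp
      dist_comm := fun x y => by rw [dist_comm]
      dist_triangle := fun x y z => by
        rw [← mul_add]
        gcongr
        exact dist_triangle x y z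
      eq_of_dist_eq_zero := fun {x y} h => by simpa [hC] using h }
  obtain ⟨F, hF, hFf⟩ := @hE Z m Y f (LipschitzWith.of_dist_le_mul fun x y =>
    (hd x y).trans (by rw [NNReal.coe_one, one_mul]; rfl))
  exact ⟨F, fun x y => (hF.dist_le_mul x y).trans_eq (one_mul _), hFf⟩

/-- Normalizing finitely many Lipschitz functions with small multiplicity. -/
theorem sum_abs_div_sum_sub_le {X V : Type*} [PseudoMetricSpace X] [Fintype V] {r : ℝ} (hr : 0 < r)
    {f : V → X → ℝ} (hf0 : ∀ v x, 0 ≤ f v x) (hflip : ∀ v x y, |f v x - f v y| ≤ dist x y)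
    (hcard : ∀ x, {v | f v x ≠ 0}.ncard ≤ 3) {F : X → ℝ} (hFf : ∀ x, F x = ∑ v, f v x)
    (hF : ∀ x, r / 2 ≤ F x) (x y : X) :
    ∑ v, |f v x / F x - f v y / F y| ≤ 84 / r * dist x y := by
  have hF0 : ∀ x, 0 < F x := fun x => by linarith [hF x]
  have hfF : ∀ v x, f v x ≤ F x := fun v x =>
    (hFf x).symm ▸ Finset.single_le_sum (fun v _ => hf0 v x) (Finset.mem_univ v)
  have hsum : ∀ (x y : X) (g : V → ℝ) (M : ℝ), (∀ v, g v ≤ M) →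
      (∀ v, f v x = 0 → f v y = 0 → g v = 0) → 0 ≤ M → ∑ v, g v ≤ 6 * M := by
    classical
    intro x y g M hg h0 hM
    set A : Finset (V) := Finset.univ.filter fun v => f v x ≠ 0
    set B : Finset (V) := Finset.univ.filter fun v => f v y ≠ 0
    have hA : A.card ≤ 3 := by
      have := hcard x
      rwa [ncard_eq_toFinset_card', toFinset_ofPred] at this
    have hB : B.card ≤ 3 := by
      have := hcard y
      rwa [ncard_eq_toFinset_card', toFinset_ofPred] at this
    have hAB : (A ∪ B).card ≤ 6 := (Finset.card_union_le _ _).trans (by omega)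
    rw [← Finset.sum_subset (Finset.subset_univ (A ∪ B))
      fun v _ hv => by simp [A, B] at hv; exact h0 v hv.1 hv.2]
    calc ∑ v ∈ A ∪ B, g v ≤ (A ∪ B).card • M := Finset.sum_le_card_nsmul _ _ _ fun v _ => hg v
      _ ≤ 6 * M := by
        rw [nsmul_eq_mul]
        gcongr
        exact_mod_cast hAB
  have hFlip : ∀ x y, |F x - F y| ≤ 6 * dist x y := by
    intro x y
    rw [hFf, hFf, ← Finset.sum_sub_distrib]
    exact (Finset.abs_sum_le_sum_abs _ _).trans
      (hsum x y _ _ (hflip · x y) (fun v h1 h2 => by simp [h1, h2]) dist_nonneg)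
  refine (hsum x y _ (14 / r * dist x y) (fun v => ?_) (fun v h1 h2 => by simp [h1, h2])
    (by positivity)).trans_eq (by ring)
  have e : f v x / F x - f v y / F y =
      ((f v x - f v y) + f v y / F y * (F y - F x)) / F x := by
    field_simp [(hF0 x).ne', (hF0 y).ne']
    ring
  have h1 : |f v y / F y| ≤ 1 := by
    rw [abs_of_nonneg (div_nonneg (hf0 v y) (hF0 y).le)]
    exact (div_le_one (hF0 y)).2 (hfF v y)
  have h2 : |f v x - f v y + f v y / F y * (F y - F x)| ≤ 7 * dist x y := by
    refine (abs_add_le _ _).trans ?_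
    rw [abs_mul, abs_sub_comm (F y)]
    have := mul_le_mul h1 (hFlip x y) (abs_nonneg _) zero_le_one
    linarith [hflip v x y]
  rw [e, abs_div, abs_of_pos (hF0 x), div_le_iff₀ (hF0 x)]
  calc _ ≤ 7 * dist x y := h2
    _ = 14 / r * dist x y * (r / 2) := by field_simp; ring
    _ ≤ _ := by gcongr; exact hF x

/-- A colouring with bounded monochromatic chains yields a Lipschitz partition of unity with small
supports and multiplicity at most three. -/
theorem exists_partition_of_coloring {X : Type} [MetricSpace X] [CompactSpace X] {r D : ℝ}
    (hr : 0 < r) {c : X → Fin 3}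
    (hcol : ∀ x y, Relation.ReflTransGen (fun x y => c x = c y ∧ dist x y ≤ r) x y →
      dist x y ≤ D * r) :
    ∃ (V : Type) (_ : Fintype V) (p : V → X → ℝ) (a : V → X),
      (∀ v x, 0 ≤ p v x) ∧ (∀ x, ∑ v, p v x = 1) ∧
      (∀ x, {v | p v x ≠ 0}.ncard ≤ 3) ∧
      (∀ x y, ∑ v, |p v x - p v y| ≤ 84 / r * dist x y) ∧
      ∀ v x, p v x ≠ 0 → dist x (a v) ≤ (D + 1) * r := by
  let step : X → X → Prop := fun x y => c x = c y ∧ dist x y ≤ r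
  have : Std.Symm step := ⟨fun x y h => ⟨h.1.symm, by rw [dist_comm]; exact h.2⟩⟩
  let s : Setoid X := ⟨Relation.ReflTransGen step, fun _ => .refl,
    fun h => Std.Symm.symm _ _ h, fun h h' => h.trans h'⟩
  have hfin : Finite (Quotient s) := by
    obtain ⟨t, -, ht, hcov⟩ := finite_approx_of_totallyBounded
      (isCompact_univ (X := X)).totallyBounded (r / 2) (half_pos hr)
    have hex : ∀ x, ∃ y ∈ t, dist x y < r / 2 := fun x => by
      simpa using hcov (mem_univ x)
    choose n hn hnd using hex
    have := ht.to_subtype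
    refine Finite.of_injective (β := t × Fin 3) (fun v => (⟨n v.out, hn _⟩, c v.out))
      fun v w hvw => ?_
    simp only [Prod.mk.injEq, Subtype.mk.injEq] at hvw
    refine Quotient.out_equiv_out.1 (Relation.ReflTransGen.single ⟨hvw.2, ?_⟩)
    have h1 := hnd v.out
    have h2 := hnd w.out
    rw [← hvw.1, dist_comm] at h2
    linarith [dist_triangle v.out (n v.out) w.out]
  let := Fintype.ofFinite (Quotient s)
  let U : Quotient s → Set X := fun v => {x | (⟦x⟧ : Quotient s) = v}
  have hUne : ∀ v, (U v).Nonempty := fun v => ⟨v.out, Quotient.out_eq v⟩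
  let f : Quotient s → X → ℝ := fun v x => max (r / 2 - infDist x (U v)) 0
  have hf0 : ∀ v x, 0 ≤ f v x := fun v x => le_max_right _ _
  have hfne : ∀ v x, f v x ≠ 0 → ∃ u, (⟦u⟧ : Quotient s) = v ∧ dist x u < r / 2 := by
    intro v x h
    refine (infDist_lt_iff (hUne v)).1 ?_
    by_contra! h'
    exact h (max_eq_right (by linarith))
  have hflip : ∀ v x y, |f v x - f v y| ≤ dist x y := by
    intro v x y
    refine (abs_max_sub_max_le_abs _ _ _).trans ?_
    have h1 := infDist_le_infDist_add_dist (s := U v) (x := x) (y := y)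
    have h2 := infDist_le_infDist_add_dist (s := U v) (x := y) (y := x)
    rw [dist_comm y] at h2
    rw [abs_le]
    constructor <;> linarith
  have hcard : ∀ x, {v | f v x ≠ 0}.ncard ≤ 3 := by
    intro x
    have : Nonempty X := ⟨x⟩
    choose! u hu hud using fun v => hfne v x
    have := ncard_le_ncard_of_injOn (s := {v | f v x ≠ 0}) (t := univ) (fun v => c (u v))
      (fun _ _ => mem_univ _) (fun v hv w hw hvw => ?_)
    · simpa [ncard_univ] using this
    · rw [← hu v hv, ← hu w hw]
      refine Quotient.sound (Relation.ReflTransGen.single ⟨hvw, ?_⟩)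
      have h1 := hud v hv
      have h2 := hud w hw
      linarith [dist_triangle_left (u v) (u w) x]
  let F : X → ℝ := fun x => ∑ v, f v x
  have hF : ∀ x, r / 2 ≤ F x := by
    intro x
    refine le_trans ?_ (Finset.single_le_sum (fun v _ => hf0 v x)
      (Finset.mem_univ (⟦x⟧ : Quotient s)))
    have : infDist x (U ⟦x⟧) = 0 := infDist_zero_of_mem rfl
    simp [f, this]
  have hF0 : ∀ x, 0 < F x := fun x => by linarith [hF x]
  refine ⟨Quotient s, inferInstance, fun v x => f v x / F x, Quotient.out,
    fun v x => div_nonneg (hf0 v x) (hF0 x).le, fun x => ?_, fun x => ?_, fun x y => ?_,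
    fun v x h => ?_⟩
  · rw [← Finset.sum_div]
    exact div_self (hF0 x).ne'
  · simpa [(hF0 x).ne'] using hcard x
  · exact sum_abs_div_sum_sub_le hr hf0 hflip hcard (fun _ => rfl) hF x y
  · obtain ⟨u, hu, hud⟩ := hfne v x fun h' => h (by simp [h'])
    have h1 : dist u v.out ≤ D * r := hcol _ _ (Quotient.exact (hu.trans (Quotient.out_eq v).symm))
    linarith [dist_triangle x u v.out]

section Simplices

theorem exists_linearIsometry_single {J W : Type*} [Fintype J] [DecidableEq J] [Fintype W]
    [DecidableEq W] {j : J → W} (hj : Function.Injective j) :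
    ∃ T : EuclideanSpace ℝ J →ₗᵢ[ℝ] EuclideanSpace ℝ W,
      ∀ i, T (EuclideanSpace.single i 1) = EuclideanSpace.single (j i) 1 := by
  let b := (EuclideanSpace.basisFun J ℝ).toBasis
  let f := b.constr ℝ fun i => EuclideanSpace.single (j i) (1 : ℝ)
  have hf : ∀ i, f (EuclideanSpace.single i 1) = EuclideanSpace.single (j i) (1 : ℝ) := fun i => by
    rw [← b.constr_basis ℝ (fun i => EuclideanSpace.single (j i) (1 : ℝ)) i]
    simp [b, f]
  refine ⟨f.isometryOfOrthonormal (v := b) (by simp [b, OrthonormalBasis.orthonormal]) ?_, hf⟩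
  have : f ∘ b = EuclideanSpace.basisFun W ℝ ∘ j := by
    ext1 i
    simp [b, hf]
  rw [this]
  exact (EuclideanSpace.basisFun W ℝ).orthonormal.comp j hj

/-- The vertices of a simplex of side length `r` spanned by `V`, inside a Euclidean space which
has at least three dimensions. -/
def vertexOf {V : Type*} [DecidableEq V] (r : ℝ) (v : V) : EuclideanSpace ℝ (V ⊕ Fin 3) :=
  (r / Real.sqrt 2) • EuclideanSpace.single (Sum.inl v) (1 : ℝ)

theorem vertexOf_inl {V : Type*} [DecidableEq V] (r : ℝ) (v w : V) :
    vertexOf r v (Sum.inl w) = if w = v then r / Real.sqrt 2 else 0 := by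
  simp [vertexOf]

variable {V : Type*} [Fintype V] [DecidableEq V] {r : ℝ} {s : Set V}

theorem nonempty_isometryEquiv_euclideanSimplex {k : Fin 3} (hs : s.ncard = k + 1) :
    Nonempty (convexHull ℝ (vertexOf r '' s) ≃ᵢ euclideanSimplex r k) := by
  obtain ⟨j, hj, hjs⟩ : ∃ j : Fin 3 → V ⊕ Fin 3, Function.Injective j ∧
      j '' {i | i ≤ k} = Sum.inl '' s := by
    fin_cases k
    · obtain ⟨a, rfl⟩ := ncard_eq_one.1 hs
      refine ⟨![.inl a, .inr 0, .inr 1], ?_, ?_⟩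
      · intro x y; fin_cases x <;> fin_cases y <;> simp
      · ext z; simp
    · obtain ⟨a, b, hab, rfl⟩ := ncard_eq_two.1 hs
      refine ⟨![.inl a, .inl b, .inr 0], ?_, ?_⟩
      · intro x y; fin_cases x <;> fin_cases y <;> simp [hab, hab.symm]
      · ext z; simp [Fin.exists_fin_succ, eq_comm]
    · obtain ⟨a, b, c, hab, hac, hbc, rfl⟩ := ncard_eq_three.1 hs
      refine ⟨![.inl a, .inl b, .inl c], ?_, ?_⟩
      · intro x y; fin_cases x <;> fin_cases y <;> simp [hab, hac, hbc, hab.symm, hac.symm, hbc.symm]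
      · ext z; simp [Fin.exists_fin_succ, eq_comm]
  obtain ⟨T, hT⟩ := exists_linearIsometry_single hj
  have himage : T '' euclideanSimplex r k = convexHull ℝ (vertexOf r '' s) := by
    have : ∀ i, T (simplexVertex r i) = (r / Real.sqrt 2) • EuclideanSpace.single (j i) (1 : ℝ) :=
      fun i => by rw [simplexVertex, map_smul, hT]
    rw [euclideanSimplex, ← LinearIsometry.coe_toLinearMap, LinearMap.image_convexHull,
      image_image]
    simp only [LinearIsometry.coe_toLinearMap, this]
    rw [← image_image (fun w => (r / Real.sqrt 2) • EuclideanSpace.single w (1 : ℝ)) j, hjs,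
      image_image]
    rfl
  rw [← himage]
  exact ⟨(IsometryEquiv.mk (Equiv.Set.image T _ T.injective)
    (Isometry.of_dist_eq fun x y => T.isometry.dist_eq _ _)).symm⟩

theorem dist_vertexOf (hr : 0 ≤ r) {v w : V} (h : v ≠ w) :
    dist (vertexOf r v) (vertexOf r w) = r := by
  have h2 : ‖EuclideanSpace.single (Sum.inl v : V ⊕ Fin 3) (1 : ℝ) -
      EuclideanSpace.single (Sum.inl w) 1‖ = Real.sqrt 2 := by
    rw [← Real.sqrt_sq (norm_nonneg _), norm_sub_sq_real, EuclideanSpace.inner_single_left]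
    simp [h]
    norm_num
  rw [dist_eq_norm, vertexOf, vertexOf, ← smul_sub, norm_smul, h2, Real.norm_of_nonneg (by positivity)]
  field_simp

theorem norm_vertexOf_le (hr : 0 ≤ r) (v : V) : ‖vertexOf r v‖ ≤ r := by
  rw [vertexOf, norm_smul, Real.norm_of_nonneg (by positivity)]
  simpa using div_le_self hr (Real.one_le_sqrt.2 one_le_two)

theorem dist_le_of_mem_convexHull (hr : 0 ≤ r) {y : EuclideanSpace ℝ (V ⊕ Fin 3)}
    (hy : y ∈ convexHull ℝ (vertexOf r '' s)) {v : V} (hv : v ∈ s) :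
    dist y (vertexOf r v) ≤ r := by
  refine convexHull_min (t := closedBall (vertexOf r v) r) ?_ (convex_closedBall _ _) hy
  rintro _ ⟨w, -, rfl⟩
  rcases eq_or_ne w v with rfl | h
  · simpa using hr
  · exact (dist_vertexOf hr h).le

theorem coord_of_mem_convexHull {y : EuclideanSpace ℝ (V ⊕ Fin 3)}
    (hy : y ∈ convexHull ℝ (vertexOf r '' s)) :
    (∀ v ∉ s, y (Sum.inl v) = 0) ∧ ∑ v, y (Sum.inl v) = r / Real.sqrt 2 := by
  let T : Set (EuclideanSpace ℝ (V ⊕ Fin 3)) :=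
    {y | (∀ v ∉ s, y (Sum.inl v) = 0) ∧ ∑ v, y (Sum.inl v) = r / Real.sqrt 2}
  refine convexHull_min (t := T) ?_ ?_ hy
  · rintro _ ⟨w, hw, rfl⟩
    refine ⟨fun v hv => ?_, ?_⟩
    · rw [vertexOf_inl, if_neg (by rintro rfl; exact hv hw)]
    · simp [vertexOf_inl]
  · rintro x ⟨hx, hx'⟩ y ⟨hy, hy'⟩ a b - - hab
    refine ⟨fun v hv => by simp [hx v hv, hy v hv], ?_⟩
    simp [Finset.sum_add_distrib, ← Finset.mul_sum, hx', hy', ← add_mul, hab]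

theorem exists_large_coord (hr : 0 < r) (hs : s.ncard ≤ 3) {y : EuclideanSpace ℝ (V ⊕ Fin 3)}
    (hy : y ∈ convexHull ℝ (vertexOf r '' s)) : ∃ v, r / 5 < y (Sum.inl v) := by
  obtain ⟨h0, h1⟩ := coord_of_mem_convexHull hy
  by_contra! h
  have hsq : r / Real.sqrt 2 > 3 * (r / 5) := by
    rw [gt_iff_lt, lt_div_iff₀ (by positivity)]
    have : Real.sqrt 2 < 5 / 3 := (Real.sqrt_lt' (by norm_num)).2 (by norm_num)
    nlinarith
  have hle : ∑ v, y (Sum.inl v) ≤ 3 * (r / 5) := by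
    classical
    rw [← Finset.sum_subset (Finset.subset_univ s.toFinset) fun v _ hv => h0 v (by simpa using hv)]
    refine (Finset.sum_le_card_nsmul _ _ _ fun v _ => h v).trans ?_
    rw [nsmul_eq_mul]
    gcongr
    rw [← ncard_eq_toFinset_card']
    exact_mod_cast hs
  linarith

theorem mem_of_dist_lt {y z : EuclideanSpace ℝ (V ⊕ Fin 3)} {v : V}
    (hv : r / 5 < y (Sum.inl v)) (hyz : dist y z ≤ r / 5)
    (hz : z ∈ convexHull ℝ (vertexOf r '' s)) : v ∈ s := by
  by_contra h
  have h0 := (coord_of_mem_convexHull hz).1 v h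
  have := (PiLp.norm_apply_le (y - z) (Sum.inl v)).trans_eq (dist_eq_norm y z).symm
  simp [h0] at this
  linarith [le_abs_self (y (Sum.inl v))]

end Simplices

/-- A coarse estimate along curves. -/
theorem ConnIn.dist_le_of_local {X Y : Type*} [PseudoMetricSpace X] [PseudoMetricSpace Y]
    {S : Set Y} {G : Y → X} {M δ L : ℝ} (hδ : 0 < δ)
    (hG : ∀ y ∈ S, ∀ z ∈ S, dist y z ≤ δ → dist (G y) (G z) ≤ M) {y z : Y} (h : ConnIn S L y z) :
    dist (G y) (G z) ≤ (L / δ + 1) * M := by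
  obtain ⟨h0, g, h1, h2, rfl, rfl⟩ := h
  have hM : 0 ≤ M := dist_nonneg.trans (hG _ (h2 0) _ (h2 0) (by simpa using hδ.le))
  have key : ∀ n : ℕ, ∀ t, 0 ≤ t → t ≤ n * δ → dist (G (g 0)) (G (g t)) ≤ n * M := by
    intro n
    induction n with
    | zero => intro t h h'; simp [le_antisymm (by simpa using h') h]
    | succ n ih =>
      intro t ht ht'
      push_cast at ht' ⊢
      have e1 := ih (max (t - δ) 0) (le_max_right _ _) (max_le (by linarith) (by positivity))
      have e2 := hG _ (h2 (max (t - δ) 0)) _ (h2 t) ((h1.dist_le_mul _ _).trans ?_)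
      · linarith [dist_triangle (G (g 0)) (G (g (max (t - δ) 0))) (G (g t))]
      · rw [NNReal.coe_one, one_mul, Real.dist_eq, abs_le]
        constructor
        · linarith [le_max_left (t - δ) 0]
        · have : max (t - δ) 0 ≤ t := max_le (by linarith) ht
          linarith
  refine (key ⌈L / δ⌉₊ L h0 ((div_le_iff₀ hδ).1 (Nat.le_ceil _))).trans ?_
  gcongr
  exact (Nat.ceil_lt_add_one (by positivity)).le

section Approximation

/-- The map to the nerve complex given by a partition of unity, together with a map back which
is determined by a point in the support of each function of the partition. -/
theorem IsGeodesicSpace.exists_complex_of_partition {X : Type} [MetricSpace X] [Nonempty X]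
    (hX : IsGeodesicSpace X) {r R : ℝ} (hr : 0 < r) {V : Type} [Fintype V] {p : V → X → ℝ}
    {a : V → X} (hp0 : ∀ v x, 0 ≤ p v x) (hp1 : ∀ x, ∑ v, p v x = 1)
    (hcard : ∀ x, {v | p v x ≠ 0}.ncard ≤ 3)
    (hlip : ∀ x y, ∑ v, |p v x - p v y| ≤ 84 / r * dist x y)
    (hpa : ∀ v x, p v x ≠ 0 → dist x (a v) ≤ R)
    {E : Type*} [MetricSpace E] (hE : IsInjectiveMetricSpace E) {ι : X → E} (hι : Isometry ι)
    {C : ℝ≥0} (hC0 : C ≠ 0) (hC : 16 * R ≤ C * r) :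
    ∃ (K : EuclideanComplex2 r) (ψ : X → K.space) (φ : K.space → E),
      LipschitzWith 84 ψ ∧ LipschitzWith C φ ∧ (∀ y, ∃ x, dist (φ y) (ι x) ≤ C * r) ∧
      ∀ x, dist (ι x) (φ (ψ x)) ≤ C * r + R := by
  classical
  let supp : X → Set V := fun x => {v | p v x ≠ 0}
  have hne : ∀ x, (supp x).Nonempty := fun x => by
    by_contra! h
    have : ∀ v, p v x = 0 := fun v => by
      by_contra hv
      exact (h ▸ hv : v ∈ (∅ : Set V))
    simpa [this] using hp1 x
  have : Nonempty V := (hne (Classical.arbitrary X)).nonempty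
  let face : range supp → Set (EuclideanSpace ℝ (V ⊕ Fin 3)) := fun s =>
    convexHull ℝ (vertexOf r '' s.1)
  have hpos : ∀ s : range supp, 0 < s.1.ncard := by
    rintro ⟨_, x, rfl⟩
    exact (ncard_pos).2 (hne x)
  have hle : ∀ s : range supp, s.1.ncard ≤ 3 := by
    rintro ⟨_, x, rfl⟩
    exact hcard x
  let ψ₀ : X → EuclideanSpace ℝ (V ⊕ Fin 3) := fun x => ∑ v, p v x • vertexOf r v
  have hψ₀ : ∀ x, ψ₀ x ∈ face ⟨supp x, x, rfl⟩ := fun x => by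
    have : ψ₀ x = ∑ v ∈ (supp x).toFinset, p v x • vertexOf r v := by
      refine (Finset.sum_subset (Finset.subset_univ _) fun v _ hv => ?_).symm
      have : p v x = 0 := by simpa [supp] using hv
      rw [this, zero_smul]
    rw [this]
    refine (convex_convexHull ℝ _).sum_mem (fun v _ => hp0 v x) ?_ fun v hv =>
      subset_convexHull ℝ _ (mem_image_of_mem _ (by simpa using hv))
    rw [← hp1 x]
    refine Finset.sum_subset (Finset.subset_univ _) fun v _ hv => by simpa [supp] using hv
  have hψ₀S : ∀ x, ψ₀ x ∈ ⋃ s, face s := fun x => mem_iUnion_of_mem _ (hψ₀ x)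
  have hψ₀lip : LipschitzWith 84 ψ₀ := by
    refine LipschitzWith.of_dist_le_mul fun x y => ?_
    rw [dist_eq_norm, ← Finset.sum_sub_distrib]
    simp only [← _root_.sub_smul]
    calc ‖∑ v, (p v x - p v y) • vertexOf r v‖
        ≤ ∑ v, ‖(p v x - p v y) • vertexOf r v‖ := norm_sum_le _ _
      _ ≤ ∑ v, |p v x - p v y| * r := by
        gcongr with v
        rw [norm_smul, Real.norm_eq_abs]
        gcongr
        exact norm_vertexOf_le hr.le v
      _ ≤ 84 / r * dist x y * r := by
        rw [← Finset.sum_mul]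
        gcongr
        exact hlip x y
      _ = (84 : ℝ≥0) * dist x y := by
        push_cast
        field_simp
  have hψconn : ∀ x y, ConnIn (⋃ s, face s) (84 * dist x y) (ψ₀ x) (ψ₀ y) := fun x y =>
    (hX.connIn (S := univ) fun _ _ => trivial).map (by norm_num) hψ₀lip fun x _ => hψ₀S x
  have hconn : ∀ y ∈ ⋃ s, face s, ∃ x, ∃ L, ConnIn (⋃ s, face s) L y (ψ₀ x) := by
    intro y hy
    obtain ⟨⟨_, x, rfl⟩, hy⟩ := mem_iUnion.1 hy
    exact ⟨x, _, ((convex_convexHull ℝ _).connIn hy (hψ₀ x)).mono le_rfl (subset_iUnion face _)⟩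
  obtain ⟨K, val, hrange, hval, hdist⟩ := exists_euclideanComplex2 (r := r) (face := face)
    (fun s => ⟨s.1.ncard - 1, by have := hle s; omega⟩) (fun s => convex_convexHull ℝ _)
    (fun s => nonempty_isometryEquiv_euclideanSimplex
      (by have := hpos s; simp only; omega))
    (fun y hy z hz => by
      obtain ⟨x, L, h⟩ := hconn y hy
      obtain ⟨x', L', h'⟩ := hconn z hz
      exact ⟨_, (h.trans (hψconn x x')).trans h'.symm⟩)
  have hlift : ∀ y ∈ ⋃ s, face s, ∃ z, val z = y := fun y hy => by
    rwa [← hrange] at hy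
  have hmem : ∀ z, val z ∈ ⋃ s, face s := fun z => hrange ▸ mem_range_self z
  choose ψ hψ using fun x => hlift _ (hψ₀S x)
  have hψlip : LipschitzWith 84 ψ := LipschitzWith.of_dist_le_mul fun x y =>
    hdist _ _ _ (by rw [hψ, hψ]; exact hψconn x y)
  have hnear : ∀ y ∈ ⋃ s, face s, ∃ v, r / 5 < y (Sum.inl v) := fun y hy => by
    obtain ⟨s, hy⟩ := mem_iUnion.1 hy
    exact exists_large_coord hr (hle s) hy
  have hlocal : ∀ y ∈ ⋃ s, face s, ∀ z ∈ ⋃ s, face s, ∀ v w, r / 5 < y (Sum.inl v) →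
      r / 5 < z (Sum.inl w) → dist y z ≤ r / 5 → dist (a v) (a w) ≤ 2 * R := by
    intro y hy z hz v w hv hw hyz
    obtain ⟨⟨_, x, rfl⟩, hz⟩ := mem_iUnion.1 hz
    have h1 := hpa v x (mem_of_dist_lt hv hyz hz)
    have h2 := hpa w x (mem_of_dist_lt hw (by simpa using by positivity) hz)
    linarith [dist_triangle_left (a v) (a w) x]
  have hvertex : ∀ v : V, r / 5 < vertexOf r v (Sum.inl v) := fun v => by
    rw [vertexOf_inl, if_pos rfl]
    gcongr
    exact (Real.sqrt_lt' (by norm_num)).2 (by norm_num)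
  choose! g hg using hnear
  have hgdist : ∀ (z : K.space) v, val z = vertexOf r v → dist (a v) (a (g (val z))) ≤ 2 * R :=
    fun z v h => hlocal _ (hmem z) _ (hmem z) _ _ (h ▸ hvertex v) (hg _ (hmem z))
      (by simpa using by positivity)
  let Y : Set K.space := {z | ∃ v, val z = vertexOf r v}
  choose vtx hvtx using fun z : Y => z.2
  have hf : LipschitzWith C (fun z : Y => ι (a (vtx z))) := by
    refine LipschitzWith.of_dist_le_mul fun y z => ?_
    rw [hι.dist_eq]
    by_cases h : vtx y = vtx z
    · rw [h, dist_self]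
      positivity
    have hr' : r ≤ dist y z := by
      refine (dist_vertexOf hr.le h).symm.trans_le ?_
      rw [← hvtx, ← hvtx]
      exact (hval y z).dist_le
    have h1 := hgdist _ _ (hvtx y)
    have h2 := hgdist _ _ (hvtx z)
    have h3 := (hval y z).dist_le_of_local (G := fun y => a (g y)) (by positivity)
      fun y hy z hz => hlocal y hy z hz _ _ (hg y hy) (hg z hz)
    have hR : 0 ≤ R := by linarith [dist_nonneg.trans h1]
    have h4 : (dist (y : K.space) z / (r / 5) + 1) * (2 * R) + 4 * R ≤ C * dist y z := by
      have h5 : 1 ≤ dist y z / r := (one_le_div hr).2 hr'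
      have h6 : 16 * R / r ≤ C := (div_le_iff₀ hr).2 hC
      calc (dist (y : K.space) z / (r / 5) + 1) * (2 * R) + 4 * R
          = dist y z / r * (10 * R) + 1 * (6 * R) := by
            rw [Subtype.dist_eq]; field_simp; ring
        _ ≤ dist y z / r * (10 * R) + dist y z / r * (6 * R) := by gcongr
        _ = 16 * R / r * dist y z := by ring
        _ ≤ _ := by gcongr
    rw [dist_comm (a (vtx z))] at h2
    linarith [dist_triangle4 (a (vtx y)) (a (g (val y))) (a (g (val z))) (a (vtx z))]
  obtain ⟨φ, hφ, hφY⟩ := hE.exists_extension hC0 hf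
  have hφv : ∀ y x v, val y ∈ face ⟨supp x, x, rfl⟩ → v ∈ supp x →
      dist (φ y) (ι (a v)) ≤ C * r := by
    intro y x v hy hv
    have hv' : vertexOf r v ∈ face ⟨supp x, x, rfl⟩ := subset_convexHull ℝ _ (mem_image_of_mem _ hv)
    obtain ⟨z, hz⟩ := hlift _ (mem_iUnion_of_mem _ hv')
    have hzY : z ∈ Y := ⟨v, hz⟩
    have : vtx ⟨z, hzY⟩ = v := by
      by_contra h
      have := dist_vertexOf hr.le h
      rw [← hvtx, hz, dist_self] at this
      exact hr.ne this
    rw [← this, ← hφY ⟨z, hzY⟩]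
    refine (hφ.dist_le_mul _ _).trans ?_
    gcongr
    refine (hdist _ _ _ (((convex_convexHull ℝ _).connIn hy (hz ▸ hv')).mono le_rfl
      (subset_iUnion face _))).trans ?_
    rw [hz]
    exact dist_le_of_mem_convexHull hr.le hy hv
  refine ⟨K, ψ, φ, hψlip, hφ, fun y => ?_, fun x => ?_⟩
  · obtain ⟨⟨_, x, rfl⟩, hy⟩ := mem_iUnion.1 (hmem y)
    obtain ⟨v, hv⟩ := hne x
    exact ⟨a v, hφv y x v hy hv⟩
  · obtain ⟨v, hv⟩ := hne x
    have h1 := hφv (ψ x) x v (hψ x ▸ hψ₀ x) hv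
    have h2 := hpa v x hv
    rw [← hι.dist_eq] at h2
    rw [dist_comm] at h1
    linarith [dist_triangle (ι x) (ι (a v)) (φ (ψ x))]

end Approximation

/-- Lemma 5.2: approximation of geodesic metric discs by finite
2-dimensional Euclidean simplicial complexes, with uniformly Lipschitz maps back and forth. -/
theorem approx_by_complex :
    ∃ C : ℝ≥0, 1 ≤ C ∧
      ∀ (X : Type) [MetricSpace X], IsGeodesicSpace X → Nonempty (X ≃ₜ ↥unitClosedDisc) →
      ∀ (E : Type) [MetricSpace E], IsInjectiveMetricSpace E →
      ∀ ι : X → E, Isometry ι → ∀ r : ℝ, 0 < r →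
        ∃ (K : EuclideanComplex2 r) (ψ : X → K.space) (φ : K.space → E),
          LipschitzWith C ψ ∧ LipschitzWith C φ ∧
          (∀ y : K.space, φ y ∈ Metric.thickening ((C : ℝ) * r) (Set.range ι)) ∧
          ∀ x : X, dist (ι x) (φ (ψ x)) ≤ (C : ℝ) * r := by
  refine ⟨200000, by norm_num, ?_⟩
  intro X _ hX ⟨e⟩ E _ hE ι hι r hr
  have : CompactSpace unitClosedDisc := isCompact_iff_compactSpace.1 (isCompact_closedBall 0 1)
  have : CompactSpace X := e.symm.compactSpace
  have : Nonempty X := ⟨e.symm ⟨0, by simp [unitClosedDisc]⟩⟩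
  let h : X → ℂ := fun x => Complex.orthonormalBasisOneI.repr.symm (e x)
  obtain ⟨c, hc⟩ := hX.exists_three_coloring (h := h) (by fun_prop)
    (Complex.orthonormalBasisOneI.repr.symm.injective.comp
      (Subtype.val_injective.comp e.injective)) hr
  obtain ⟨V, _, p, a, h0, h1, h2, h3, h4⟩ := exists_partition_of_coloring hr hc
  obtain ⟨K, ψ, φ, hψ, hφ, hφι, hψφ⟩ := hX.exists_complex_of_partition hr h0 h1 h2 h3 h4 hE hι
    (C := 150000) (by norm_num) (by push_cast; linarith)
  refine ⟨K, ψ, φ, hψ.weaken (by norm_num), hφ.weaken (by norm_num), fun y => ?_, fun x => ?_⟩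
  · obtain ⟨x, hx⟩ := hφι y
    refine mem_thickening_iff.2 ⟨ι x, mem_range_self x, hx.trans_lt ?_⟩
    push_cast
    linarith
  · refine (hψφ x).trans ?_
    push_cast
    linarith

end
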